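/- arXiv:1707.06893 — 2 statements merged into one kernel-verified Lean document; each statement's English description precedes it below -/
import Mathlib

section
/- The only pair of natural numbers (n, m) with n ≥ 4 and m ≥ 12 satisfying C(n, 2) = C(m, 6) (where C denotes the binomial coefficient) is (n, m) = (78, 14), with common value 3003. -/
/-- The ring `ℤ[x] / (x⁴ + f₃ x³ + f₂ x² + f₁ x + f₀)`, in coordinates with respect to
`1, x, x², x³`. -/
@[ext]
structure QuarticOrder (f₀ f₁ f₂ f₃ : ℤ) where
  x₀ : ℤ
  x₁ : ℤ
  x₂ : ℤ
  x₃ : ℤ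

namespace QuarticOrder

variable {f₀ f₁ f₂ f₃ : ℤ}

instance : DecidableEq (QuarticOrder f₀ f₁ f₂ f₃) := fun a b =>
  decidable_of_iff (a.x₀ = b.x₀ ∧ a.x₁ = b.x₁ ∧ a.x₂ = b.x₂ ∧ a.x₃ = b.x₃)
    QuarticOrder.ext_iff.symm

instance : Zero (QuarticOrder f₀ f₁ f₂ f₃) := ⟨⟨0, 0, 0, 0⟩⟩
instance : One (QuarticOrder f₀ f₁ f₂ f₃) := ⟨⟨1, 0, 0, 0⟩⟩
instance : Add (QuarticOrder f₀ f₁ f₂ f₃) :=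
  ⟨fun a b => ⟨a.x₀ + b.x₀, a.x₁ + b.x₁, a.x₂ + b.x₂, a.x₃ + b.x₃⟩⟩
instance : Neg (QuarticOrder f₀ f₁ f₂ f₃) := ⟨fun a => ⟨-a.x₀, -a.x₁, -a.x₂, -a.x₃⟩⟩
instance : Sub (QuarticOrder f₀ f₁ f₂ f₃) :=
  ⟨fun a b => ⟨a.x₀ - b.x₀, a.x₁ - b.x₁, a.x₂ - b.x₂, a.x₃ - b.x₃⟩⟩
instance : IntCast (QuarticOrder f₀ f₁ f₂ f₃) := ⟨fun n => ⟨n, 0, 0, 0⟩⟩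
instance : NatCast (QuarticOrder f₀ f₁ f₂ f₃) := ⟨fun n => ⟨n, 0, 0, 0⟩⟩

/-- The coefficient of `x⁶` in the product of two representatives. -/
def c₆ (a b : QuarticOrder f₀ f₁ f₂ f₃) : ℤ := a.x₃ * b.x₃

/-- The coefficient of `x⁵` after reduction of the term of degree six. -/
def c₅ (a b : QuarticOrder f₀ f₁ f₂ f₃) : ℤ := a.x₂ * b.x₃ + a.x₃ * b.x₂ - c₆ a b * f₃

/-- The coefficient of `x⁴` after reduction of the terms of degrees six and five. -/
def c₄ (a b : QuarticOrder f₀ f₁ f₂ f₃) : ℤ :=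
  a.x₁ * b.x₃ + a.x₂ * b.x₂ + a.x₃ * b.x₁ - c₆ a b * f₂ - c₅ a b * f₃

instance : Mul (QuarticOrder f₀ f₁ f₂ f₃) :=
  ⟨fun a b =>
    ⟨a.x₀ * b.x₀ - c₄ a b * f₀,
     a.x₀ * b.x₁ + a.x₁ * b.x₀ - c₅ a b * f₀ - c₄ a b * f₁,
     a.x₀ * b.x₂ + a.x₁ * b.x₁ + a.x₂ * b.x₀ - c₆ a b * f₀ - c₅ a b * f₁ - c₄ a b * f₂,
     a.x₀ * b.x₃ + a.x₁ * b.x₂ + a.x₂ * b.x₁ + a.x₃ * b.x₀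
       - c₆ a b * f₁ - c₅ a b * f₂ - c₄ a b * f₃⟩⟩

section coordinates

variable (a b : QuarticOrder f₀ f₁ f₂ f₃) (n : ℤ) (k : ℕ)

@[simp] lemma zero_x₀ : (0 : QuarticOrder f₀ f₁ f₂ f₃).x₀ = 0 := rfl
@[simp] lemma zero_x₁ : (0 : QuarticOrder f₀ f₁ f₂ f₃).x₁ = 0 := rfl
@[simp] lemma zero_x₂ : (0 : QuarticOrder f₀ f₁ f₂ f₃).x₂ = 0 := rfl
@[simp] lemma zero_x₃ : (0 : QuarticOrder f₀ f₁ f₂ f₃).x₃ = 0 := rfl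
@[simp] lemma one_x₀ : (1 : QuarticOrder f₀ f₁ f₂ f₃).x₀ = 1 := rfl
@[simp] lemma one_x₁ : (1 : QuarticOrder f₀ f₁ f₂ f₃).x₁ = 0 := rfl
@[simp] lemma one_x₂ : (1 : QuarticOrder f₀ f₁ f₂ f₃).x₂ = 0 := rfl
@[simp] lemma one_x₃ : (1 : QuarticOrder f₀ f₁ f₂ f₃).x₃ = 0 := rfl
@[simp] lemma add_x₀ : (a + b).x₀ = a.x₀ + b.x₀ := rfl
@[simp] lemma add_x₁ : (a + b).x₁ = a.x₁ + b.x₁ := rfl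
@[simp] lemma add_x₂ : (a + b).x₂ = a.x₂ + b.x₂ := rfl
@[simp] lemma add_x₃ : (a + b).x₃ = a.x₃ + b.x₃ := rfl
@[simp] lemma neg_x₀ : (-a).x₀ = -a.x₀ := rfl
@[simp] lemma neg_x₁ : (-a).x₁ = -a.x₁ := rfl
@[simp] lemma neg_x₂ : (-a).x₂ = -a.x₂ := rfl
@[simp] lemma neg_x₃ : (-a).x₃ = -a.x₃ := rfl
@[simp] lemma sub_x₀ : (a - b).x₀ = a.x₀ - b.x₀ := rfl
@[simp] lemma sub_x₁ : (a - b).x₁ = a.x₁ - b.x₁ := rfl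
@[simp] lemma sub_x₂ : (a - b).x₂ = a.x₂ - b.x₂ := rfl
@[simp] lemma sub_x₃ : (a - b).x₃ = a.x₃ - b.x₃ := rfl
@[simp] lemma intCast_x₀ : (n : QuarticOrder f₀ f₁ f₂ f₃).x₀ = n := rfl
@[simp] lemma intCast_x₁ : (n : QuarticOrder f₀ f₁ f₂ f₃).x₁ = 0 := rfl
@[simp] lemma intCast_x₂ : (n : QuarticOrder f₀ f₁ f₂ f₃).x₂ = 0 := rfl
@[simp] lemma intCast_x₃ : (n : QuarticOrder f₀ f₁ f₂ f₃).x₃ = 0 := rfl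
@[simp] lemma natCast_x₀ : (k : QuarticOrder f₀ f₁ f₂ f₃).x₀ = k := rfl
@[simp] lemma natCast_x₁ : (k : QuarticOrder f₀ f₁ f₂ f₃).x₁ = 0 := rfl
@[simp] lemma natCast_x₂ : (k : QuarticOrder f₀ f₁ f₂ f₃).x₂ = 0 := rfl
@[simp] lemma natCast_x₃ : (k : QuarticOrder f₀ f₁ f₂ f₃).x₃ = 0 := rfl
lemma mul_x₀ : (a * b).x₀ = a.x₀ * b.x₀ - c₄ a b * f₀ := rfl
lemma mul_x₁ : (a * b).x₁ = a.x₀ * b.x₁ + a.x₁ * b.x₀ - c₅ a b * f₀ - c₄ a b * f₁ := rfl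
lemma mul_x₂ : (a * b).x₂ =
    a.x₀ * b.x₂ + a.x₁ * b.x₁ + a.x₂ * b.x₀ - c₆ a b * f₀ - c₅ a b * f₁ - c₄ a b * f₂ := rfl
lemma mul_x₃ : (a * b).x₃ = a.x₀ * b.x₃ + a.x₁ * b.x₂ + a.x₂ * b.x₁ + a.x₃ * b.x₀
    - c₆ a b * f₁ - c₅ a b * f₂ - c₄ a b * f₃ := rfl

end coordinates

instance : CommRing (QuarticOrder f₀ f₁ f₂ f₃) where
  add_assoc a b c := by ext <;> simp [add_assoc]
  zero_add a := by ext <;> simp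
  add_zero a := by ext <;> simp
  add_comm a b := by ext <;> simp [add_comm]
  neg_add_cancel a := by ext <;> simp
  sub_eq_add_neg a b := by ext <;> simp [sub_eq_add_neg]
  zero_mul a := by ext <;> simp [mul_x₀, mul_x₁, mul_x₂, mul_x₃, c₄, c₅, c₆]
  mul_zero a := by ext <;> simp [mul_x₀, mul_x₁, mul_x₂, mul_x₃, c₄, c₅, c₆]
  one_mul a := by ext <;> simp [mul_x₀, mul_x₁, mul_x₂, mul_x₃, c₄, c₅, c₆]
  mul_one a := by ext <;> simp [mul_x₀, mul_x₁, mul_x₂, mul_x₃, c₄, c₅, c₆]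
  mul_comm a b := by ext <;> simp only [mul_x₀, mul_x₁, mul_x₂, mul_x₃, c₄, c₅, c₆] <;> ring
  mul_assoc a b c := by
    ext <;> simp only [mul_x₀, mul_x₁, mul_x₂, mul_x₃, c₄, c₅, c₆] <;> ring
  left_distrib a b c := by
    ext <;> simp only [mul_x₀, mul_x₁, mul_x₂, mul_x₃, add_x₀, add_x₁, add_x₂, add_x₃,
      c₄, c₅, c₆] <;> ring
  right_distrib a b c := by
    ext <;> simp only [mul_x₀, mul_x₁, mul_x₂, mul_x₃, add_x₀, add_x₁, add_x₂, add_x₃,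
      c₄, c₅, c₆] <;> ring
  natCast_zero := rfl
  natCast_succ n := by ext <;> simp
  intCast_ofNat n := by ext <;> simp
  intCast_negSucc n := by ext <;> simp [Int.negSucc_eq]
  nsmul := nsmulRec
  zsmul := zsmulRec

/-- Evaluation at a root of the defining polynomial. -/
def evalHom {S : Type*} [CommRing S] (r : S) (hr : r ^ 4 + f₃ * r ^ 3 + f₂ * r ^ 2 + f₁ * r + f₀ = 0) :
    QuarticOrder f₀ f₁ f₂ f₃ →+* S where
  toFun a := a.x₀ + a.x₁ * r + a.x₂ * r ^ 2 + a.x₃ * r ^ 3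
  map_zero' := by simp
  map_one' := by simp
  map_add' a b := by simp; ring
  map_mul' a b := by
    have h6 : ((c₆ a b : ℤ) : S) = a.x₃ * b.x₃ := by simp [c₆]
    have h5 : ((c₅ a b : ℤ) : S) = a.x₂ * b.x₃ + a.x₃ * b.x₂ - c₆ a b * f₃ := by simp [c₅]
    have h4 : ((c₄ a b : ℤ) : S) =
        a.x₁ * b.x₃ + a.x₂ * b.x₂ + a.x₃ * b.x₁ - c₆ a b * f₂ - c₅ a b * f₃ := by simp [c₄]
    simp only [mul_x₀, mul_x₁, mul_x₂, mul_x₃]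
    push_cast
    linear_combination (-(c₆ a b : S) * r ^ 2 - c₅ a b * r - c₄ a b) * hr + r ^ 6 * h6 + r ^ 5 * h5 + r ^ 4 * h4

lemma evalHom_apply {S : Type*} [CommRing S] (r : S)
    (hr : r ^ 4 + f₃ * r ^ 3 + f₂ * r ^ 2 + f₁ * r + f₀ = 0) (a : QuarticOrder f₀ f₁ f₂ f₃) :
    evalHom r hr a = a.x₀ + a.x₁ * r + a.x₂ * r ^ 2 + a.x₃ * r ^ 3 := rfl

lemma intCast_mul (n : ℤ) (a : QuarticOrder f₀ f₁ f₂ f₃) :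
    (n : QuarticOrder f₀ f₁ f₂ f₃) * a = ⟨n * a.x₀, n * a.x₁, n * a.x₂, n * a.x₃⟩ := by
  ext <;> simp [mul_x₀, mul_x₁, mul_x₂, mul_x₃, c₄, c₅, c₆]

end QuarticOrder

lemma exists_add_pow_eq {R : Type*} [CommRing R] (x y : R) (n : ℕ) :
    ∃ t, (x + y) ^ (n + 2) = x ^ (n + 2) + (n + 2) * x ^ (n + 1) * y +
      ((n + 2).choose 2 : ℕ) * x ^ n * y ^ 2 + y ^ 3 * t := by
  induction n with
  | zero => exact ⟨0, by norm_num; ring⟩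
  | succ n ih =>
    obtain ⟨t, ht⟩ := ih
    refine ⟨t * (x + y) + ((n + 2).choose 2 : ℕ) * x ^ n, ?_⟩
    have h : ((n + 1 + 2).choose 2 : ℕ) = (n + 2) + (n + 2).choose 2 := by
      rw [Nat.choose_succ_succ' (n + 2) 1]; simp
    rw [pow_succ, ht, h]; push_cast; ring

/-- Modulo `p ^ (k + v + 1)`, the `n`-th power is linear on `A + p ^ k R`, if `p ^ v ∣ n`. -/
lemma exists_add_prime_pow_mul_pow {R : Type*} [CommRing R] {p : ℕ} (hp : p.Prime) (hp2 : 2 < p)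
    {k : ℕ} (hk : 1 ≤ k) (A Y : R) (v n : ℕ) (hv : p ^ v ∣ n) :
    ∃ W, (A + p ^ k * Y) ^ n = A ^ n + n * A ^ (n - 1) * (p ^ k * Y) + p ^ (k + 1 + v) * W := by
  induction v generalizing n with
  | zero =>
    obtain ⟨k, rfl⟩ := Nat.exists_eq_add_of_le' hk
    match n with
    | 0 => exact ⟨0, by simp⟩
    | 1 => exact ⟨0, by simp⟩
    | n + 2 =>
      obtain ⟨t, ht⟩ := exists_add_pow_eq A (p ^ (k + 1) * Y) n
      rw [ht]
      refine ⟨((n + 2).choose 2 : ℕ) * A ^ n * (p ^ k * Y ^ 2) + p ^ (2 * k + 1) * Y ^ 3 * t, ?_⟩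
      rw [show n + 2 - 1 = n + 1 by omega]
      push_cast; ring
  | succ v ih =>
    obtain ⟨m, rfl⟩ := hv
    obtain ⟨W, hW⟩ := ih (p ^ v * m) ⟨m, rfl⟩
    obtain ⟨q, rfl⟩ : ∃ q, p = q + 2 := ⟨p - 2, by omega⟩
    set n := (q + 2) ^ v * m with hn
    obtain ⟨k, rfl⟩ := Nat.exists_eq_add_of_le' hk
    obtain ⟨c, hc⟩ : (q + 2) ∣ (q + 2).choose 2 := hp.dvd_choose_self (by norm_num) hp2
    set P : R := ((q + 2 : ℕ) : R) with hP
    set B := A ^ n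
    set X := (m * A ^ (n - 1) * Y + P * W) with hX
    have hnR : (n : R) = P ^ v * m := by rw [hn, hP]; push_cast; ring
    have hW' : (A + P ^ (k + 1) * Y) ^ n = B + P ^ (k + 1 + v) * X := by
      rw [hW, hnR, hX]; ring
    obtain ⟨t, ht⟩ := exists_add_pow_eq B (P ^ (k + 1 + v) * X) q
    have e1 : (q + 2) ^ (v + 1) * m = n * (q + 2) := by rw [hn]; ring
    rw [e1, pow_mul, hW', ht, hc]
    have e2 : A ^ (n * (q + 2) - 1) = A ^ (n - 1) * B ^ (q + 1) ∨ n = 0 := by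
      rcases Nat.eq_zero_or_pos n with h | h
      · exact Or.inr h
      · left
        rw [← pow_mul, ← pow_add]
        congr 1
        obtain ⟨n', hn'⟩ : ∃ n', n = n' + 1 := ⟨n - 1, by omega⟩
        rw [hn', show (n' + 1) * (q + 2) = n' + (n' + 1) * (q + 1) + 1 by ring]; omega
    refine ⟨W * B ^ (q + 1) + c * B ^ q * P ^ (k + v) * X ^ 2 +
      P ^ (2 * k + 2 * v) * X ^ 3 * t, ?_⟩
    have hP2 : (q : R) + 2 = P := by rw [hP]; push_cast; ring
    have e3 : ((n * (q + 2) : ℕ) : R) * A ^ (n * (q + 2) - 1) = P ^ (v + 1) * m * (A ^ (n - 1) * B ^ (q + 1)) := by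
      rcases e2 with h | h
      · rw [h, Nat.cast_mul, hnR]; ring
      · have : P ^ v * m = 0 := by rw [← hnR, h]; simp
        rw [show P ^ (v + 1) * m = 0 by linear_combination P * this]
        simp [h]
    rw [e3, hP2, ← pow_mul, hX, Nat.cast_mul, ← hP]
    ring

lemma exists_one_add_prime_mul_zpow {R : Type*} [CommRing R] {p : ℕ} (hp : p.Prime) (hp2 : 2 < p)
    (ε : Rˣ) (E : R) (hε : (ε : R) = 1 + p * E) (v : ℕ) (z : ℤ) (hv : (p : ℤ) ^ v ∣ z) :
    ∃ W, ((ε ^ z : Rˣ) : R) = 1 + z * (p * E) + p ^ (v + 2) * W := by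
  obtain ⟨n, rfl | rfl⟩ := z.eq_nat_or_neg
  all_goals
    have hn : p ^ v ∣ n := by
      have := Int.natAbs_dvd_natAbs.2 hv
      simpa [Int.natAbs_pow] using this
    obtain ⟨W, hW⟩ := exists_add_prime_pow_mul_pow hp hp2 le_rfl 1 E v n hn
    rw [pow_one, ← hε] at hW
  · refine ⟨W, ?_⟩
    rw [zpow_natCast, Units.val_pow_eq_pow_val, hW, add_comm v 2]
    simp
  · obtain ⟨m, rfl⟩ := hn
    have h : ((ε ^ (-((p ^ v * m : ℕ) : ℤ)) : Rˣ) : R) * (ε : R) ^ (p ^ v * m) = 1 := by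
      rw [zpow_neg, zpow_natCast, ← Units.val_pow_eq_pow_val, Units.inv_mul]
    rw [hW] at h
    set I : R := ((ε ^ (-((p ^ v * m : ℕ) : ℤ)) : Rˣ) : R)
    refine ⟨p ^ v * (m * E + p * W) ^ 2 * I - W, ?_⟩
    push_cast at h ⊢
    simp only [one_pow, mul_one] at h
    linear_combination (1 - p ^ (v + 1) * (m * E + p * W)) * h

namespace QuarticOrder

variable {f₀ f₁ f₂ f₃ : ℤ}

lemma pow_dvd_of_dvd_coordinates {p : ℕ} (hp : p.Prime) (hp2 : 2 < p)
    (ε η : (QuarticOrder f₀ f₁ f₂ f₃)ˣ) (E H : QuarticOrder f₀ f₁ f₂ f₃)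
    (hε : (ε : QuarticOrder f₀ f₁ f₂ f₃) = 1 + p * E)
    (hη : (η : QuarticOrder f₀ f₁ f₂ f₃) = 1 + p * H)
    (hd : ¬ (p : ℤ) ∣ E.x₂ * H.x₃ - E.x₃ * H.x₂) (a b : ℤ) (t : ℕ)
    (h₂ : (p : ℤ) ^ (t + 1) ∣ ((ε ^ a * η ^ b : (QuarticOrder f₀ f₁ f₂ f₃)ˣ) :
      QuarticOrder f₀ f₁ f₂ f₃).x₂)
    (h₃ : (p : ℤ) ^ (t + 1) ∣ ((ε ^ a * η ^ b : (QuarticOrder f₀ f₁ f₂ f₃)ˣ) :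
      QuarticOrder f₀ f₁ f₂ f₃).x₃) :
    (p : ℤ) ^ t ∣ a ∧ (p : ℤ) ^ t ∣ b := by
  induction t with
  | zero => simp
  | succ t ih =>
    obtain ⟨ha, hb⟩ := ih ((pow_dvd_pow _ (by omega)).trans h₂) ((pow_dvd_pow _ (by omega)).trans h₃)
    obtain ⟨V, hV⟩ := exists_one_add_prime_mul_zpow hp hp2 ε E hε t a ha
    obtain ⟨W, hW⟩ := exists_one_add_prime_mul_zpow hp hp2 η H hη t b hb
    obtain ⟨a, rfl⟩ := ha
    obtain ⟨b, rfl⟩ := hb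
    set q : ℤ := (p : ℤ) with hq
    have hpq : Prime q := Nat.prime_iff_prime_int.1 hp
    have hpR : (p : QuarticOrder f₀ f₁ f₂ f₃) = ((q : ℤ) : QuarticOrder f₀ f₁ f₂ f₃) := by
      rw [hq]; push_cast; rfl
    obtain ⟨Z, hZ⟩ : ∃ Z, ((ε ^ (q ^ t * a) * η ^ (q ^ t * b) : (QuarticOrder f₀ f₁ f₂ f₃)ˣ) :
      QuarticOrder f₀ f₁ f₂ f₃) = 1 + ((q ^ (t + 1) : ℤ) : QuarticOrder f₀ f₁ f₂ f₃) *
        ((a : QuarticOrder f₀ f₁ f₂ f₃) * E + (b : QuarticOrder f₀ f₁ f₂ f₃) * H)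
        + ((q ^ (t + 2) : ℤ) : QuarticOrder f₀ f₁ f₂ f₃) * Z := by
      refine ⟨V + W + q ^ t * (a * E) * (b * H) + q ^ (t + 1) * ((a * E) * W + V * (b * H))
        + q ^ (t + 2) * V * W, ?_⟩
      rw [Units.val_mul, hV, hW, hpR]
      push_cast
      ring
    rw [hZ] at h₂ h₃
    simp only [intCast_mul, add_x₂, add_x₃, one_x₂, one_x₃] at h₂ h₃
    have hq0 : q ^ (t + 1) ≠ 0 := pow_ne_zero _ hpq.ne_zero
    have key : ∀ x y : ℤ, q ^ (t + 1 + 1) ∣ 0 + q ^ (t + 1) * x + q ^ (t + 2) * y → q ∣ x := by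
      intro x y h
      have : q ^ (t + 1) * q ∣ q ^ (t + 1) * x := by
        rw [← pow_succ]
        have h2 : q ^ (t + 1 + 1) ∣ q ^ (t + 2) * y := ⟨y, by ring⟩
        simpa using (Int.dvd_sub h h2)
      exact (mul_dvd_mul_iff_left hq0).1 this
    have k₂ := key _ _ h₂
    have k₃ := key _ _ h₃
    constructor
    · rw [pow_succ]
      refine mul_dvd_mul_left _ ((hpq.dvd_or_dvd (?_ : q ∣ (E.x₂ * H.x₃ - E.x₃ * H.x₂) * a)).resolve_left hd)
      convert Int.dvd_sub (k₂.mul_left H.x₃) (k₃.mul_left H.x₂) using 1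
      ring
    · rw [pow_succ]
      refine mul_dvd_mul_left _ ((hpq.dvd_or_dvd (?_ : q ∣ (E.x₂ * H.x₃ - E.x₃ * H.x₂) * b)).resolve_left hd)
      convert Int.dvd_sub (k₃.mul_left E.x₂) (k₂.mul_left E.x₃) using 1
      ring

lemma eq_zero_of_zpow_mul_zpow_eq_one {p : ℕ} (hp : p.Prime) (hp2 : 2 < p)
    (ε η : (QuarticOrder f₀ f₁ f₂ f₃)ˣ) (E H : QuarticOrder f₀ f₁ f₂ f₃)
    (hε : (ε : QuarticOrder f₀ f₁ f₂ f₃) = 1 + p * E)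
    (hη : (η : QuarticOrder f₀ f₁ f₂ f₃) = 1 + p * H)
    (hd : ¬ (p : ℤ) ∣ E.x₂ * H.x₃ - E.x₃ * H.x₂) (a b : ℤ) (h : ε ^ a * η ^ b = 1) :
    a = 0 ∧ b = 0 := by
  have key : ∀ t, (p : ℤ) ^ t ∣ a ∧ (p : ℤ) ^ t ∣ b := fun t =>
    pow_dvd_of_dvd_coordinates hp hp2 ε η E H hε hη hd a b t (by simp [h]) (by simp [h])
  have hp1 : (1 : ℤ) < p := by exact_mod_cast hp.one_lt
  have zero : ∀ x : ℤ, (∀ t, (p : ℤ) ^ t ∣ x) → x = 0 := by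
    intro x hx
    by_contra h0
    exact Int.finiteMultiplicity_iff.2 ⟨by simpa using hp.ne_one, h0⟩ |>.not_pow_dvd_of_multiplicity_lt
      (Nat.lt_succ_self _) (hx _)
  exact ⟨zero a fun t => (key t).1, zero b fun t => (key t).2⟩

/-- Skolem's `p`-adic argument: a linear form `P - Q x` with `p ∣ Q` cannot have a power in the
group generated by two units which are `1` modulo `p`, unless `Q = 0`. -/
lemma eq_zero_of_pow_eq_zpow_mul_zpow {p : ℕ} (hp : p.Prime) (hp2 : 2 < p)
    (ε η : (QuarticOrder f₀ f₁ f₂ f₃)ˣ) (E H : QuarticOrder f₀ f₁ f₂ f₃)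
    (hε : (ε : QuarticOrder f₀ f₁ f₂ f₃) = 1 + p * E)
    (hη : (η : QuarticOrder f₀ f₁ f₂ f₃) = 1 + p * H)
    (hd : ¬ (p : ℤ) ∣ E.x₂ * H.x₃ - E.x₃ * H.x₂) (a b : ℤ)
    {P Q : ℤ} (hQ : (p : ℤ) ∣ Q) (hP : ¬ (p : ℤ) ∣ P) {n : ℕ} (hn : n ≠ 0)
    (h : ((ε ^ a * η ^ b : (QuarticOrder f₀ f₁ f₂ f₃)ˣ) : QuarticOrder f₀ f₁ f₂ f₃) =
      ⟨P, -Q, 0, 0⟩ ^ n) : Q = 0 := by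
  by_contra hQ0
  have hpq : Prime (p : ℤ) := Nat.prime_iff_prime_int.1 hp
  obtain ⟨Q', hQ1, hQ'⟩ := (Int.finiteMultiplicity_iff.2
    ⟨by simpa using hp.ne_one, hQ0⟩ : FiniteMultiplicity (p : ℤ) Q).exists_eq_pow_mul_and_not_dvd
  obtain ⟨v, n', hn', rfl⟩ := Nat.exists_eq_pow_mul_and_not_dvd hn p hp.ne_one
  set k := multiplicity (p : ℤ) Q
  have hk : 1 ≤ k := by
    by_contra hk
    rw [show k = 0 by omega, pow_zero, one_mul] at hQ1
    exact hQ' (hQ1 ▸ hQ)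
  set q : ℤ := (p : ℤ) with hq
  have hpR : (p : QuarticOrder f₀ f₁ f₂ f₃) = ((q : ℤ) : QuarticOrder f₀ f₁ f₂ f₃) := by
    rw [hq]; push_cast; rfl
  obtain ⟨W, hW⟩ := exists_add_prime_pow_mul_pow hp hp2 hk
    ((P : ℤ) : QuarticOrder f₀ f₁ f₂ f₃) ⟨0, -Q', 0, 0⟩ v (p ^ v * n') ⟨n', rfl⟩
  have hu : (P : QuarticOrder f₀ f₁ f₂ f₃) + p ^ k * ⟨0, -Q', 0, 0⟩ = ⟨P, -Q, 0, 0⟩ := by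
    rw [hpR, ← Int.cast_pow, intCast_mul, hQ1]
    ext <;> simp
  have hexp : ((ε ^ a * η ^ b : (QuarticOrder f₀ f₁ f₂ f₃)ˣ) : QuarticOrder f₀ f₁ f₂ f₃) =
      ((P ^ (p ^ v * n') : ℤ) : QuarticOrder f₀ f₁ f₂ f₃)
      + ((q ^ (k + v) * (n' * P ^ (p ^ v * n' - 1)) : ℤ) : QuarticOrder f₀ f₁ f₂ f₃) *
        ⟨0, -Q', 0, 0⟩
      + ((q ^ (k + v + 1) : ℤ) : QuarticOrder f₀ f₁ f₂ f₃) * W := by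
    rw [h, ← hu, hW, Nat.cast_mul, Nat.cast_pow, hpR]
    push_cast
    ring
  obtain ⟨ha, hb⟩ := pow_dvd_of_dvd_coordinates hp hp2 ε η E H hε hη hd a b (k + v)
    (by rw [hexp]; simp only [intCast_mul, add_x₂, intCast_x₂]; simp [hq])
    (by rw [hexp]; simp only [intCast_mul, add_x₃, intCast_x₃]; simp [hq])
  obtain ⟨V, hV⟩ := exists_one_add_prime_mul_zpow hp hp2 ε E hε _ a ha
  obtain ⟨V', hV'⟩ := exists_one_add_prime_mul_zpow hp hp2 η H hη _ b hb
  obtain ⟨a, rfl⟩ := ha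
  obtain ⟨b, rfl⟩ := hb
  obtain ⟨Z, hZ⟩ : ∃ Z, ((ε ^ (q ^ (k + v) * a) * η ^ (q ^ (k + v) * b) :
      (QuarticOrder f₀ f₁ f₂ f₃)ˣ) : QuarticOrder f₀ f₁ f₂ f₃) =
      1 + ((q ^ (k + v + 1) : ℤ) : QuarticOrder f₀ f₁ f₂ f₃) * Z := by
    refine ⟨(a * E + b * H) + q * (V + V') + q ^ (k + v + 1) * (a * E + q * V) * (b * H + q * V'), ?_⟩
    rw [Units.val_mul, hV, hV']
    push_cast
    simp only [← hpR]
    ring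
  have h₁ := congrArg QuarticOrder.x₁ (hexp.symm.trans hZ)
  simp only [intCast_mul, add_x₁, one_x₁, intCast_x₁] at h₁
  have hdvd : q ^ (k + v) * q ∣ q ^ (k + v) * (n' * P ^ (p ^ v * n' - 1) * Q') :=
    ⟨W.x₁ - Z.x₁, by linear_combination -h₁⟩
  have h4 := (mul_dvd_mul_iff_left (pow_ne_zero _ hpq.ne_zero)).1 hdvd
  rcases hpq.dvd_or_dvd h4 with h5 | h5
  · rcases hpq.dvd_or_dvd h5 with h6 | h6
    · exact hn' (Int.natCast_dvd_natCast.1 h6)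
    · exact hP (hpq.dvd_of_dvd_pow h6)
  · exact hQ' h5

end QuarticOrder

open NumberField Polynomial

lemma NumberField.Units.rank_le_two_of_finrank_eq_four (K : Type*) [Field K] [NumberField K]
    (hK : Module.finrank ℚ K = 4) (φ : K →+* ℂ) (hφ : ¬ ComplexEmbedding.IsReal φ) :
    Units.rank K ≤ 2 := by
  classical
  have h1 := InfinitePlace.card_add_two_mul_card_eq_rank K
  have h2 : Fintype.card (InfinitePlace K) =
    InfinitePlace.nrRealPlaces K + InfinitePlace.nrComplexPlaces K :=
    InfinitePlace.card_eq_nrRealPlaces_add_nrComplexPlaces K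
  have h3 : 0 < InfinitePlace.nrComplexPlaces K :=
    Fintype.card_pos_iff.2 ⟨⟨InfinitePlace.mk φ, by
      rw [InfinitePlace.isComplex_iff]
      intro h
      rcases InfinitePlace.embedding_mk_eq φ with h' | h'
      · exact hφ (h' ▸ h)
      · rw [h'] at h
        exact hφ (ComplexEmbedding.isReal_conjugate_iff.1 h)⟩⟩
  unfold Units.rank
  omega

set_option maxSynthPendingDepth 3 in
lemma NumberField.Units.exists_zpow_mul_zpow_mul_zpow_eq_one {K : Type*} [Field K] [NumberField K]
    (hK : Units.rank K ≤ 2) (u v w : (𝓞 K)ˣ) :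
    ∃ a b c : ℤ, ¬ (a = 0 ∧ b = 0 ∧ c = 0) ∧ u ^ a * v ^ b * w ^ c = 1 := by
  let x : (𝓞 K)ˣ → Additive ((𝓞 K)ˣ ⧸ torsion K) := fun u => Additive.ofMul (QuotientGroup.mk u)
  have hdep : ¬ LinearIndependent ℤ ![x u, x v, x w] := by
    intro h
    have := h.fintype_card_le_finrank
    rw [Units.finrank_modTorsion, Fintype.card_fin] at this
    omega
  rw [Fintype.not_linearIndependent_iff] at hdep
  obtain ⟨g, hg, i, hi⟩ := hdep
  have h1 : u ^ g 0 * v ^ g 1 * w ^ g 2 ∈ torsion K := by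
    rw [← QuotientGroup.eq_one_iff]
    simpa [Fin.sum_univ_three, x, ← ofMul_zpow, ← ofMul_mul] using hg
  obtain ⟨n, hn, h2⟩ := isOfFinOrder_iff_pow_eq_one.1 ((CommGroup.mem_torsion _).1 h1)
  refine ⟨g 0 * n, g 1 * n, g 2 * n, ?_, ?_⟩
  · rintro ⟨h0, h1, h2⟩
    have hn' : (n : ℤ) ≠ 0 := by exact_mod_cast hn.ne'
    have e0 := (mul_eq_zero.1 h0).resolve_right hn'
    have e1 := (mul_eq_zero.1 h1).resolve_right hn'
    have e2 := (mul_eq_zero.1 h2).resolve_right hn'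
    fin_cases i
    exacts [hi e0, hi e1, hi e2]
  · simpa [mul_pow, zpow_mul, zpow_natCast] using h2

namespace QuarticOrder

variable {f₀ f₁ f₂ f₃ : ℤ}

/-- The defining polynomial of `QuarticOrder f₀ f₁ f₂ f₃`. -/
noncomputable def poly (f₀ f₁ f₂ f₃ : ℤ) : ℤ[X] :=
  X ^ 4 + (C f₃ * X ^ 3 + C f₂ * X ^ 2 + C f₁ * X + C f₀)

lemma monic_poly : (poly f₀ f₁ f₂ f₃).Monic := by
  unfold poly
  apply monic_X_pow_add
  compute_degree!

lemma natDegree_poly : (poly f₀ f₁ f₂ f₃).natDegree = 4 := by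
  unfold poly
  compute_degree!

/-- The field generated by a root of the defining polynomial. -/
abbrev FractionField (f₀ f₁ f₂ f₃ : ℤ) : Type :=
  AdjoinRoot ((poly f₀ f₁ f₂ f₃).map (Int.castRingHom ℚ))

lemma eval₂_map_poly {S : Type*} [CommRing S] [Algebra ℚ S] (r : S) :
    ((poly f₀ f₁ f₂ f₃).map (Int.castRingHom ℚ)).eval₂ (algebraMap ℚ S) r =
      r ^ 4 + f₃ * r ^ 3 + f₂ * r ^ 2 + f₁ * r + f₀ := by
  unfold poly
  rw [Polynomial.eval₂_map]
  simp only [eval₂_add, eval₂_mul, eval₂_pow, eval₂_X, eval₂_C]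
  simp
  ring

/-- The root of the defining polynomial which generates the field. -/
noncomputable def root (f₀ f₁ f₂ f₃ : ℤ) : FractionField f₀ f₁ f₂ f₃ := AdjoinRoot.root _

lemma root_spec : (root f₀ f₁ f₂ f₃) ^ 4 + f₃ * (root f₀ f₁ f₂ f₃) ^ 3 +
    f₂ * (root f₀ f₁ f₂ f₃) ^ 2 + f₁ * (root f₀ f₁ f₂ f₃) + f₀ = 0 := by
  rw [← eval₂_map_poly]
  exact AdjoinRoot.eval₂_root ((poly f₀ f₁ f₂ f₃).map (Int.castRingHom ℚ))

lemma injective_evalHom_fractionField :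
    Function.Injective (evalHom (root f₀ f₁ f₂ f₃) root_spec) := by
  rw [injective_iff_map_eq_zero]
  intro a ha
  set F := (poly f₀ f₁ f₂ f₃).map (Int.castRingHom ℚ) with hF
  have hmon : F.Monic := monic_poly.map _
  have hdeg : F.natDegree = 4 := by rw [hF, monic_poly.natDegree_map, natDegree_poly]
  let g : ℚ[X] := C (a.x₀ : ℚ) + C (a.x₁ : ℚ) * X + C (a.x₂ : ℚ) * X ^ 2 + C (a.x₃ : ℚ) * X ^ 3
  have hg : AdjoinRoot.mk F g = 0 := by
    rw [← ha, evalHom_apply]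
    simp [g, root, F]
  rw [AdjoinRoot.mk_eq_zero] at hg
  have hg0 : g = 0 := by
    refine Polynomial.eq_zero_of_dvd_of_natDegree_lt hg ?_
    rw [hdeg]
    have : g.natDegree ≤ 3 := by simp only [g]; compute_degree
    omega
  have hc : ∀ n, g.coeff n = 0 := fun n => by rw [hg0, coeff_zero]
  have h0 := hc 0
  have h1 := hc 1
  have h2 := hc 2
  have h3 := hc 3
  simp only [g, coeff_add, coeff_C_mul, coeff_X_pow, coeff_X, coeff_C] at h0 h1 h2 h3
  norm_num at h0 h1 h2 h3
  ext <;> assumption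

section

variable [hirr : Fact (Irreducible ((poly f₀ f₁ f₂ f₃).map (Int.castRingHom ℚ)))]

lemma injective_evalHom {S : Type*} [Field S] [CharZero S] (r : S)
    (hr : r ^ 4 + f₃ * r ^ 3 + f₂ * r ^ 2 + f₁ * r + f₀ = 0) :
    Function.Injective (evalHom (f₀ := f₀) (f₁ := f₁) (f₂ := f₂) (f₃ := f₃) r hr) := by
  let ψ : FractionField f₀ f₁ f₂ f₃ →+* S :=
    AdjoinRoot.lift (algebraMap ℚ S) r (by rw [eval₂_map_poly, hr])
  have : ∀ a, evalHom r hr a = ψ (evalHom _ root_spec a) := by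
    intro a
    simp [evalHom_apply, ψ, root]
  intro a b hab
  rw [this, this] at hab
  exact injective_evalHom_fractionField (ψ.injective hab)

lemma eq_one_or_eq_neg_one_of_pow_eq_one (r : ℝ)
    (hr : r ^ 4 + f₃ * r ^ 3 + f₂ * r ^ 2 + f₁ * r + f₀ = 0) (τ : QuarticOrder f₀ f₁ f₂ f₃)
    {n : ℕ} (hn : n ≠ 0) (h : τ ^ n = 1) : τ = 1 ∨ τ = -1 := by
  have h1 : (evalHom r hr τ) ^ n = 1 := by rw [← map_pow, h, map_one]
  have h2 : |evalHom r hr τ| = 1 := by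
    rw [← pow_eq_one_iff_of_nonneg (abs_nonneg _) hn, ← abs_pow, h1, abs_one]
  rcases (abs_eq zero_le_one).1 h2 with h3 | h3
  · exact Or.inl (injective_evalHom r hr (by rw [h3, map_one]))
  · exact Or.inr (injective_evalHom r hr (by rw [h3, map_neg, map_one]))

/-- Any three units of an order of mixed signature are multiplicatively dependent. -/
lemma exists_zpow_mul_zpow_mul_zpow_eq_one (r : ℂ)
    (hr : r ^ 4 + f₃ * r ^ 3 + f₂ * r ^ 2 + f₁ * r + f₀ = 0) (him : 0 < r.im)
    (u v w : (QuarticOrder f₀ f₁ f₂ f₃)ˣ) :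
    ∃ a b c : ℤ, ¬ (a = 0 ∧ b = 0 ∧ c = 0) ∧ u ^ a * v ^ b * w ^ c = 1 := by
  set F := (poly f₀ f₁ f₂ f₃).map (Int.castRingHom ℚ) with hF
  have hmon : F.Monic := monic_poly.map _
  have hdeg : F.natDegree = 4 := by rw [hF, monic_poly.natDegree_map, natDegree_poly]
  let K := FractionField f₀ f₁ f₂ f₃
  have hfr : Module.finrank ℚ K = 4 := by
    rw [(AdjoinRoot.powerBasis hmon.ne_zero).finrank, AdjoinRoot.powerBasis_dim, hdeg]
  have : FiniteDimensional ℚ K := (AdjoinRoot.powerBasis hmon.ne_zero).finite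
  have : NumberField K := ⟨⟩
  let φ : K →+* ℂ :=
    AdjoinRoot.lift (algebraMap ℚ ℂ) r (by rw [eval₂_map_poly, hr])
  have hφ : ¬ ComplexEmbedding.IsReal φ := by
    intro h
    have h1 := congrArg (fun g : K →+* ℂ => g (AdjoinRoot.root F)) h
    simp only [ComplexEmbedding.conjugate_coe_eq] at h1
    rw [show φ (AdjoinRoot.root F) = r from AdjoinRoot.lift_root _] at h1
    exact him.ne' (Complex.conj_eq_iff_im.1 h1)
  let θ : 𝓞 K := ⟨AdjoinRoot.root F, ⟨poly f₀ f₁ f₂ f₃, monic_poly, by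
    have h := AdjoinRoot.eval₂_root F
    rw [hF, Polynomial.eval₂_map] at h
    have e : (algebraMap ℚ K).comp (Int.castRingHom ℚ) = algebraMap ℤ K := RingHom.ext_int _ _
    exact (congrArg (fun g => eval₂ g (AdjoinRoot.root F) (poly f₀ f₁ f₂ f₃)) e).symm.trans h⟩⟩
  have hθK : algebraMap (𝓞 K) K θ = root f₀ f₁ f₂ f₃ := rfl
  have hθ : θ ^ 4 + f₃ * θ ^ 3 + f₂ * θ ^ 2 + f₁ * θ + f₀ = 0 := by
    apply RingOfIntegers.ext
    simp only [map_add, map_mul, map_pow, map_intCast, hθK, map_zero]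
    exact root_spec
  have hinj : Function.Injective (evalHom θ hθ) := by
    intro a b hab
    apply injective_evalHom_fractionField
    have := congrArg (algebraMap (𝓞 K) K) hab
    simpa only [evalHom_apply, map_add, map_mul, map_pow, map_intCast, hθK] using this
  obtain ⟨a, b, c, h0, h⟩ := Units.exists_zpow_mul_zpow_mul_zpow_eq_one
    (Units.rank_le_two_of_finrank_eq_four K hfr φ hφ)
    (Units.map (evalHom θ hθ : _ →* _) u) (Units.map (evalHom θ hθ : _ →* _) v)
    (Units.map (evalHom θ hθ : _ →* _) w)
  refine ⟨a, b, c, h0, ?_⟩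
  apply Units.map_injective (f := (evalHom θ hθ : QuarticOrder f₀ f₁ f₂ f₃ →* 𝓞 K)) hinj
  simpa using h

end

end QuarticOrder

namespace QuarticOrder

variable {f₀ f₁ f₂ f₃ : ℤ}

/-- Coordinatewise reduction modulo `M`. -/
def red (M : ℤ) (x : QuarticOrder f₀ f₁ f₂ f₃) : QuarticOrder f₀ f₁ f₂ f₃ :=
  ⟨x.x₀ % M, x.x₁ % M, x.x₂ % M, x.x₃ % M⟩

lemma exists_eq_red_add (M : ℤ) (x : QuarticOrder f₀ f₁ f₂ f₃) :
    ∃ k : QuarticOrder f₀ f₁ f₂ f₃, x = red M x + (M : QuarticOrder f₀ f₁ f₂ f₃) * k := by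
  refine ⟨⟨x.x₀ / M, x.x₁ / M, x.x₂ / M, x.x₃ / M⟩, ?_⟩
  rw [intCast_mul]
  ext <;> simp [red, Int.emod_add_mul_ediv]

lemma red_add_intCast_mul (M : ℤ) (x k : QuarticOrder f₀ f₁ f₂ f₃) :
    red M (x + (M : QuarticOrder f₀ f₁ f₂ f₃) * k) = red M x := by
  rw [intCast_mul]
  simp [red]

/-- Powers reduced modulo `M`. -/
def powMod (M : ℤ) (x : QuarticOrder f₀ f₁ f₂ f₃) : ℕ → QuarticOrder f₀ f₁ f₂ f₃
  | 0 => 1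
  | n + 1 => red M (x * powMod M x n)

lemma exists_pow_eq_powMod_add (M : ℤ) (x : QuarticOrder f₀ f₁ f₂ f₃) (n : ℕ) :
    ∃ k : QuarticOrder f₀ f₁ f₂ f₃, x ^ n = powMod M x n + (M : QuarticOrder f₀ f₁ f₂ f₃) * k := by
  induction n with
  | zero => exact ⟨0, by simp [powMod]⟩
  | succ n ih =>
    obtain ⟨k, hk⟩ := ih
    obtain ⟨j, hj⟩ := exists_eq_red_add M (x * powMod M x n)
    refine ⟨x * k + j, ?_⟩
    rw [pow_succ', hk, mul_add, powMod]
    nth_rw 1 [hj]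
    ring

/-- A unit from an element and its inverse. -/
def unitOfMul (x y : QuarticOrder f₀ f₁ f₂ f₃) (h : x * y = 1) : (QuarticOrder f₀ f₁ f₂ f₃)ˣ :=
  ⟨x, y, h, by rw [mul_comm, h]⟩

/-! ### Characters -/

/-- The value at `x` of the character with roots and exponents `L`, in `ZMod p`. -/
def charVal (p : ℕ) (L : List (ℕ × ℕ)) (x : QuarticOrder f₀ f₁ f₂ f₃) : ZMod p :=
  (L.map fun z => ((x.x₀ + x.x₁ * z.1 + x.x₂ * z.1 ^ 2 + x.x₃ * z.1 ^ 3 : ZMod p)) ^ z.2).prod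

/-- A computable version of `charVal`. -/
def charNat (p : ℕ) (L : List (ℕ × ℕ)) (x : QuarticOrder f₀ f₁ f₂ f₃) : ℕ :=
  (L.map fun z =>
    ((x.x₀ + x.x₁ * z.1 + x.x₂ * z.1 ^ 2 + x.x₃ * z.1 ^ 3) % p).toNat ^ z.2).prod % p

lemma toNat_emod_cast (p : ℕ) [NeZero p] (a : ℤ) : (((a % p).toNat : ℕ) : ZMod p) = a := by
  have h : (((a % p).toNat : ℕ) : ℤ) = a % p :=
    Int.toNat_of_nonneg (Int.emod_nonneg _ (by exact_mod_cast NeZero.ne p))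
  have := congrArg (Int.cast : ℤ → ZMod p) h
  rw [ZMod.intCast_mod] at this
  exact_mod_cast this

lemma charNat_cast (p : ℕ) [NeZero p] (L : List (ℕ × ℕ)) (x : QuarticOrder f₀ f₁ f₂ f₃) :
    ((charNat p L x : ℕ) : ZMod p) = charVal p L x := by
  simp only [charNat, charVal, ZMod.natCast_mod, Nat.cast_list_prod, List.map_map]
  congr 1
  apply List.map_congr_left
  intro z _
  simp [toNat_emod_cast]

variable (f₀ f₁ f₂ f₃) in
/-- The elements of `L` consist of a root modulo `p` and an exponent annihilated by `d`. -/
def IsCharacter (p d : ℕ) (L : List (ℕ × ℕ)) : Prop :=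
  ∀ z ∈ L, (p : ℤ) ∣ (z.1 : ℤ) ^ 4 + f₃ * z.1 ^ 3 + f₂ * z.1 ^ 2 + f₁ * z.1 + f₀ ∧
    p - 1 ∣ d * z.2

instance (p d : ℕ) (L : List (ℕ × ℕ)) : Decidable (IsCharacter f₀ f₁ f₂ f₃ p d L) := by
  unfold IsCharacter; infer_instance

/-- The character as a homomorphism. -/
def charHom {p d : ℕ} {L : List (ℕ × ℕ)} (hL : IsCharacter f₀ f₁ f₂ f₃ p d L) :
    QuarticOrder f₀ f₁ f₂ f₃ →* ZMod p where
  toFun := charVal p L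
  map_one' := by simp [charVal]
  map_mul' x y := by
    unfold charVal
    rw [← List.prod_map_mul]
    congr 1
    apply List.map_congr_left
    intro z hz
    have hr : ((z.1 : ZMod p)) ^ 4 + f₃ * (z.1 : ZMod p) ^ 3 + f₂ * (z.1 : ZMod p) ^ 2 +
        f₁ * (z.1 : ZMod p) + f₀ = 0 := by
      have := (ZMod.intCast_zmod_eq_zero_iff_dvd _ p).2 (hL z hz).1
      exact_mod_cast this
    rw [← mul_pow]
    congr 1
    exact map_mul (evalHom _ hr) x y

lemma charHom_apply {p d : ℕ} {L : List (ℕ × ℕ)} (hL : IsCharacter f₀ f₁ f₂ f₃ p d L)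
    (x : QuarticOrder f₀ f₁ f₂ f₃) : charHom hL x = charVal p L x := rfl

lemma charHom_pow_eq_one {p d : ℕ} [Fact p.Prime] {L : List (ℕ × ℕ)}
    (hL : IsCharacter f₀ f₁ f₂ f₃ p d L) (x : (QuarticOrder f₀ f₁ f₂ f₃)ˣ) :
    (charHom hL x) ^ d = 1 := by
  rw [charHom_apply]
  unfold charVal
  rw [← powMonoidHom_apply, map_list_prod, List.map_map]
  apply List.prod_eq_one
  intro y hy
  obtain ⟨z, hz, rfl⟩ := List.mem_map.1 hy
  have hr : ((z.1 : ZMod p)) ^ 4 + f₃ * (z.1 : ZMod p) ^ 3 + f₂ * (z.1 : ZMod p) ^ 2 +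
      f₁ * (z.1 : ZMod p) + f₀ = 0 := by
    have := (ZMod.intCast_zmod_eq_zero_iff_dvd _ p).2 (hL z hz).1
    exact_mod_cast this
  have hu : IsUnit (evalHom _ hr (x : QuarticOrder f₀ f₁ f₂ f₃)) := x.isUnit.map _
  obtain ⟨k, hk⟩ := (hL z hz).2
  rw [Function.comp_apply, powMonoidHom_apply, ← pow_mul, mul_comm z.2, hk, pow_mul]
  rw [evalHom_apply] at hu
  rw [ZMod.pow_card_sub_one_eq_one hu.ne_zero, one_pow]

lemma charHom_eq_one_of_charNat {p d : ℕ} [Fact p.Prime] {L : List (ℕ × ℕ)}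
    (hL : IsCharacter f₀ f₁ f₂ f₃ p d L) {x : QuarticOrder f₀ f₁ f₂ f₃} (h : charNat p L x = 1) :
    charHom hL x = 1 := by
  rw [charHom_apply, ← charNat_cast, h, Nat.cast_one]

lemma charNat_of_charHom_eq_one {p d : ℕ} [Fact p.Prime] {L : List (ℕ × ℕ)}
    (hL : IsCharacter f₀ f₁ f₂ f₃ p d L) {x : QuarticOrder f₀ f₁ f₂ f₃} (h : charHom hL x = 1) :
    charNat p L x = 1 := by
  rw [charHom_apply, ← charNat_cast, ← Nat.cast_one, ZMod.natCast_eq_natCast_iff'] at h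
  have hp : 1 < p := (Fact.out : p.Prime).one_lt
  rwa [Nat.mod_eq_of_lt hp, charNat, Nat.mod_mod] at h

/-! ### Saturation -/

/-- The group generated by `e₁` and `e₂` is `ℓ`-saturated up to torsion. -/
def Saturated (ℓ : ℕ) (e₁ e₂ : (QuarticOrder f₀ f₁ f₂ f₃)ˣ) : Prop :=
  ∀ (X σ : (QuarticOrder f₀ f₁ f₂ f₃)ˣ) (a b : ℤ), σ = 1 ∨ σ = -1 →
    X ^ ℓ = σ * (e₁ ^ a * e₂ ^ b) → (ℓ : ℤ) ∣ a ∧ (ℓ : ℤ) ∣ b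

lemma dvd_of_charHom {ℓ q : ℕ} (hℓ : ℓ.Prime) [Fact q.Prime] {L : List (ℕ × ℕ)}
    (hL : IsCharacter f₀ f₁ f₂ f₃ q ℓ L) (e₁ e₂ X σ : (QuarticOrder f₀ f₁ f₂ f₃)ˣ) {a b : ℤ}
    (hσ : σ = 1 ∨ σ = -1) (h : X ^ ℓ = σ * (e₁ ^ a * e₂ ^ b))
    (hneg : charNat q L (-1 : QuarticOrder f₀ f₁ f₂ f₃) = 1)
    (h₁ : charNat q L (e₁ : QuarticOrder f₀ f₁ f₂ f₃) = 1)
    (h₂ : charNat q L (e₂ : QuarticOrder f₀ f₁ f₂ f₃) ≠ 1) : (ℓ : ℤ) ∣ b := by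
  let χ := Units.map (charHom hL)
  have hX : χ X ^ ℓ = 1 := Units.ext (charHom_pow_eq_one hL X)
  have he : χ e₂ ^ ℓ = 1 := Units.ext (charHom_pow_eq_one hL e₂)
  have hσ' : χ σ = 1 := by
    rcases hσ with rfl | rfl
    · exact map_one _
    · exact Units.ext (charHom_eq_one_of_charNat hL hneg)
  have he₁ : χ e₁ = 1 := Units.ext (charHom_eq_one_of_charNat hL h₁)
  have h3 : χ e₂ ^ b = 1 := by
    have := congrArg χ h
    rw [map_pow, hX, map_mul, map_mul, hσ', map_zpow, he₁, map_zpow] at this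
    simpa using this.symm
  have ho : orderOf (χ e₂) = ℓ := by
    have : Fact ℓ.Prime := ⟨hℓ⟩
    refine orderOf_eq_prime he fun h => h₂ (charNat_of_charHom_eq_one hL ?_)
    exact congrArg Units.val h
  rw [← ho]
  exact orderOf_dvd_iff_zpow_eq_one.2 h3

lemma saturated_of_characters {ℓ q : ℕ} (hℓ : ℓ.Prime) [Fact q.Prime] {L M : List (ℕ × ℕ)}
    (hL : IsCharacter f₀ f₁ f₂ f₃ q ℓ L) (hM : IsCharacter f₀ f₁ f₂ f₃ q ℓ M)
    {e₁ e₂ : (QuarticOrder f₀ f₁ f₂ f₃)ˣ}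
    (h : charNat q L (-1 : QuarticOrder f₀ f₁ f₂ f₃) = 1 ∧
      charNat q L (e₁ : QuarticOrder f₀ f₁ f₂ f₃) = 1 ∧
      charNat q L (e₂ : QuarticOrder f₀ f₁ f₂ f₃) ≠ 1 ∧
      charNat q M (-1 : QuarticOrder f₀ f₁ f₂ f₃) = 1 ∧
      charNat q M (e₂ : QuarticOrder f₀ f₁ f₂ f₃) = 1 ∧
      charNat q M (e₁ : QuarticOrder f₀ f₁ f₂ f₃) ≠ 1) : Saturated ℓ e₁ e₂ := by
  obtain ⟨h1, h2, h3, h4, h5, h6⟩ := h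
  intro X σ a b hσ hX
  refine ⟨dvd_of_charHom hℓ hM e₂ e₁ X σ hσ (by rw [hX, mul_comm (e₁ ^ a)]) h4 h5 h6,
    dvd_of_charHom hℓ hL e₁ e₂ X σ hσ hX h1 h2 h3⟩

/-- All elements with coordinates in `[0, M)` have an `ℓ`-th power outside `T` modulo `ℓ * M`. -/
def PowersAvoid (ℓ M : ℕ) (T : List (QuarticOrder f₀ f₁ f₂ f₃)) : Prop :=
  ∀ x₀ ∈ List.range M, ∀ x₁ ∈ List.range M, ∀ x₂ ∈ List.range M, ∀ x₃ ∈ List.range M,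
    powMod (ℓ * M : ℕ) (⟨x₀, x₁, x₂, x₃⟩ : QuarticOrder f₀ f₁ f₂ f₃) ℓ ∉ T

instance (ℓ M : ℕ) (T : List (QuarticOrder f₀ f₁ f₂ f₃)) : Decidable (PowersAvoid ℓ M T) := by
  unfold PowersAvoid; infer_instance

lemma red_powMod {M : ℤ} (x : QuarticOrder f₀ f₁ f₂ f₃) {n : ℕ} (hn : n ≠ 0) :
    red M (powMod M x n) = powMod M x n := by
  obtain ⟨n, rfl⟩ := Nat.exists_eq_succ_of_ne_zero hn
  simp [powMod, red]

lemma red_pow_notMem {ℓ M : ℕ} (hℓ : ℓ ≠ 0) (hM : M ≠ 0) (hd : ℓ ∣ M)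
    {T : List (QuarticOrder f₀ f₁ f₂ f₃)} (hT : PowersAvoid ℓ M T)
    (X : QuarticOrder f₀ f₁ f₂ f₃) : red (ℓ * M : ℕ) (X ^ ℓ) ∉ T := by
  obtain ⟨k, hk⟩ := exists_eq_red_add (M : ℤ) X
  obtain ⟨n, rfl⟩ := hd
  set Y := red ((ℓ * n : ℕ) : ℤ) X with hY
  obtain ⟨t, ht⟩ := Polynomial.powAddExpansion Y ((((ℓ * n : ℕ) : ℤ) : QuarticOrder f₀ f₁ f₂ f₃) * k) ℓ
  obtain ⟨j, hj⟩ := exists_pow_eq_powMod_add ((ℓ * (ℓ * n) : ℕ) : ℤ) Y ℓ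
  have h : X ^ ℓ = powMod ((ℓ * (ℓ * n) : ℕ) : ℤ) Y ℓ +
      (((ℓ * (ℓ * n) : ℕ) : ℤ) : QuarticOrder f₀ f₁ f₂ f₃) *
      (j + Y ^ (ℓ - 1) * k + t * n * k ^ 2) := by
    rw [hk, ht, hj]
    push_cast
    ring
  rw [h, red_add_intCast_mul, red_powMod _ hℓ]
  have hpos : (0 : ℤ) < (ℓ * n : ℕ) := by exact_mod_cast Nat.pos_of_ne_zero hM
  have key : ∀ x : ℤ, ∃ m < ℓ * n, (m : ℤ) = x % (ℓ * n : ℕ) := fun x =>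
    ⟨(x % (ℓ * n : ℕ)).toNat, by have := Int.emod_lt_of_pos x hpos; have := Int.emod_nonneg x hpos.ne'; omega,
      Int.toNat_of_nonneg (Int.emod_nonneg x hpos.ne')⟩
  obtain ⟨m₀, h₀, e₀⟩ := key X.x₀
  obtain ⟨m₁, h₁, e₁⟩ := key X.x₁
  obtain ⟨m₂, h₂, e₂⟩ := key X.x₂
  obtain ⟨m₃, h₃, e₃⟩ := key X.x₃
  have := hT m₀ (List.mem_range.2 h₀) m₁ (List.mem_range.2 h₁) m₂ (List.mem_range.2 h₂)
    m₃ (List.mem_range.2 h₃)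
  rwa [e₀, e₁, e₂, e₃] at this

lemma saturated_of_powersAvoid {ℓ M : ℕ} (hℓ : ℓ ≠ 0) (hM : M ≠ 0) (hd : ℓ ∣ M)
    {T : List (QuarticOrder f₀ f₁ f₂ f₃)} (hT : PowersAvoid ℓ M T)
    {e₁ e₂ : (QuarticOrder f₀ f₁ f₂ f₃)ˣ}
    (h : ∀ a < ℓ, ∀ b < ℓ, a = 0 ∧ b = 0 ∨
      red (ℓ * M : ℕ) ((e₁ : QuarticOrder f₀ f₁ f₂ f₃) ^ a * (e₂ : QuarticOrder f₀ f₁ f₂ f₃) ^ b) ∈ T ∧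
      red (ℓ * M : ℕ) (-((e₁ : QuarticOrder f₀ f₁ f₂ f₃) ^ a * (e₂ : QuarticOrder f₀ f₁ f₂ f₃) ^ b)) ∈ T) :
    Saturated ℓ e₁ e₂ := by
  intro X σ a b hσ hX
  have hpos : (0 : ℤ) < ℓ := by exact_mod_cast Nat.pos_of_ne_zero hℓ
  have key : ∀ x : ℤ, ∃ m < ℓ, x = ℓ * (x / ℓ) + (m : ℕ) := fun x =>
    ⟨(x % ℓ).toNat, by have := Int.emod_lt_of_pos x hpos; have := Int.emod_nonneg x hpos.ne'; omega,
      by rw [Int.toNat_of_nonneg (Int.emod_nonneg x hpos.ne'), Int.mul_ediv_add_emod]⟩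
  obtain ⟨m, hm, ha⟩ := key a
  obtain ⟨n, hn, hb⟩ := key b
  set Y := X * e₁ ^ (-(a / ℓ)) * e₂ ^ (-(b / ℓ)) with hYdef
  have hY : Y ^ ℓ = σ * (e₁ ^ m * e₂ ^ n) := by
    rw [hYdef, mul_pow, mul_pow, hX, ← zpow_natCast (e₁ ^ _), ← zpow_natCast (e₂ ^ _), ← zpow_mul,
      ← zpow_mul, ← zpow_natCast e₁ m, ← zpow_natCast e₂ n]
    nth_rw 1 [ha, hb]
    rw [zpow_add, zpow_add, neg_mul, neg_mul, zpow_neg, zpow_neg, mul_comm (a / ℓ), mul_comm (b / ℓ),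
      mul_inv_eq_iff_eq_mul, mul_inv_eq_iff_eq_mul]
    generalize e₁ ^ ((ℓ : ℤ) * (a / ℓ)) = A
    generalize e₂ ^ ((ℓ : ℤ) * (b / ℓ)) = B
    generalize e₁ ^ (m : ℤ) = C
    generalize e₂ ^ (n : ℤ) = D
    ac_rfl
  have hnot := red_pow_notMem hℓ hM hd hT (Y : QuarticOrder f₀ f₁ f₂ f₃)
  rw [← Units.val_pow_eq_pow_val, hY] at hnot
  rcases h m hm n hn with ⟨rfl, rfl⟩ | ⟨h1, h2⟩
  · exact ⟨⟨_, by simpa using ha⟩, ⟨_, by simpa using hb⟩⟩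
  · exfalso
    rcases hσ with rfl | rfl
    · exact hnot (by simpa using h1)
    · exact hnot (by simpa using h2)

end QuarticOrder

namespace QuarticOrder

open Polynomial

variable {f₀ f₁ f₂ f₃ : ℤ}

lemma _root_.Complex.exists_quadratic_root (a b : ℂ) : ∃ x : ℂ, x ^ 2 + a * x + b = 0 := by
  have hd : (X ^ 2 + C a * X + C b : ℂ[X]).degree = 2 := by compute_degree!
  obtain ⟨x, hx⟩ := IsAlgClosed.exists_root (X ^ 2 + C a * X + C b : ℂ[X]) (by rw [hd]; decide)
  exact ⟨x, by simpa [IsRoot] using hx⟩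

lemma _root_.Complex.exists_cubic_root (a b c : ℂ) :
    ∃ x : ℂ, x ^ 3 + a * x ^ 2 + b * x + c = 0 := by
  have hd : (X ^ 3 + C a * X ^ 2 + C b * X + C c : ℂ[X]).degree = 3 := by compute_degree!
  obtain ⟨x, hx⟩ := IsAlgClosed.exists_root (X ^ 3 + C a * X ^ 2 + C b * X + C c : ℂ[X])
    (by rw [hd]; decide)
  exact ⟨x, by simpa [IsRoot] using hx⟩

lemma _root_.Complex.exists_quartic_root (a b c d : ℂ) :
    ∃ x : ℂ, x ^ 4 + a * x ^ 3 + b * x ^ 2 + c * x + d = 0 := by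
  have hd : (X ^ 4 + C a * X ^ 3 + C b * X ^ 2 + C c * X + C d : ℂ[X]).degree = 4 := by
    compute_degree!
  obtain ⟨x, hx⟩ := IsAlgClosed.exists_root
    (X ^ 4 + C a * X ^ 3 + C b * X ^ 2 + C c * X + C d : ℂ[X]) (by rw [hd]; decide)
  exact ⟨x, by simpa [IsRoot] using hx⟩

/-- A real quartic of negative discriminant has a root in the upper half plane. -/
lemma _root_.Complex.exists_quartic_root_im_pos (a b c d : ℝ)
    (h : 4 * (12 * d - 3 * a * c + b ^ 2) ^ 3 <
      (72 * b * d + 9 * a * b * c - 27 * c ^ 2 - 27 * d * a ^ 2 - 2 * b ^ 3) ^ 2) :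
    ∃ w : ℂ, w ^ 4 + a * w ^ 3 + b * w ^ 2 + c * w + d = 0 ∧ 0 < w.im := by
  by_contra! hno
  have hreal : ∀ w : ℂ, w ^ 4 + a * w ^ 3 + b * w ^ 2 + c * w + d = 0 → ((w.re : ℝ) : ℂ) = w := by
    intro w hw
    have h1 := hno w hw
    have h2 := hno (starRingEnd ℂ w) (by
      have := congrArg (starRingEnd ℂ) hw
      simpa using this)
    rw [Complex.conj_im] at h2
    exact Complex.ext (by simp) (by simp; linarith)
  obtain ⟨r, hr⟩ := Complex.exists_quartic_root a b c d
  have er := hreal r hr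
  set ρ := r.re
  rw [← er] at hr
  have hr' : ρ ^ 4 + a * ρ ^ 3 + b * ρ ^ 2 + c * ρ + d = 0 := by exact_mod_cast hr
  obtain ⟨s, hs⟩ := Complex.exists_cubic_root (a + ρ) (b + (a + ρ) * ρ) (c + (b + (a + ρ) * ρ) * ρ)
  have es := hreal s (by linear_combination (s - ρ) * hs + hr)
  set σ := s.re
  rw [← es] at hs
  have hs' : σ ^ 3 + (a + ρ) * σ ^ 2 + (b + (a + ρ) * ρ) * σ + (c + (b + (a + ρ) * ρ) * ρ) = 0 := by
    exact_mod_cast hs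
  obtain ⟨t, ht⟩ := Complex.exists_quadratic_root (a + ρ + σ) (b + (a + ρ) * ρ + (a + ρ + σ) * σ)
  have et := hreal t (by linear_combination (t - ρ) * (t - σ) * ht + (t - ρ) * hs + hr)
  set τ := t.re
  rw [← et] at ht
  have ht' : τ ^ 2 + (a + ρ + σ) * τ + (b + (a + ρ) * ρ + (a + ρ + σ) * σ) = 0 := by
    exact_mod_cast ht
  obtain ⟨υ, hυ⟩ : ∃ υ, υ = -(a + ρ + σ + τ) := ⟨_, rfl⟩
  have ha : a = -(ρ + σ + τ + υ) := by linarith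
  have hb : b = ρ * σ + ρ * τ + ρ * υ + σ * τ + σ * υ + τ * υ := by
    rw [ha] at ht'; linear_combination ht'
  have hc : c = -(ρ * σ * τ + ρ * σ * υ + ρ * τ * υ + σ * τ * υ) := by
    rw [ha, hb] at hs'; linear_combination hs'
  have hd : d = ρ * σ * τ * υ := by
    rw [ha, hb, hc] at hr'; linear_combination hr'
  have key : 4 * (12 * d - 3 * a * c + b ^ 2) ^ 3 -
      (72 * b * d + 9 * a * b * c - 27 * c ^ 2 - 27 * d * a ^ 2 - 2 * b ^ 3) ^ 2 =
      27 * ((ρ - σ) * (ρ - τ) * (ρ - υ) * (σ - τ) * (σ - υ) * (τ - υ)) ^ 2 := by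
    rw [ha, hb, hc, hd]; ring
  have := sq_nonneg ((ρ - σ) * (ρ - τ) * (ρ - υ) * (σ - τ) * (σ - υ) * (τ - υ))
  linarith

lemma exists_real_root {t T : ℤ} (ht : t ^ 4 + f₃ * t ^ 3 + f₂ * t ^ 2 + f₁ * t + f₀ ≤ 0)
    (hT : 0 ≤ T ^ 4 + f₃ * T ^ 3 + f₂ * T ^ 2 + f₁ * T + f₀) :
    ∃ r : ℝ, r ^ 4 + f₃ * r ^ 3 + f₂ * r ^ 2 + f₁ * r + f₀ = 0 :=
  mem_range_of_exists_le_of_exists_ge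
    (f := fun r : ℝ => r ^ 4 + f₃ * r ^ 3 + f₂ * r ^ 2 + f₁ * r + f₀) (by fun_prop)
    ⟨t, by exact_mod_cast ht⟩ ⟨T, by exact_mod_cast hT⟩

lemma irreducible_of_zmod {q : ℕ} (hq : q.Prime)
    (h₁ : ∀ a : ZMod q, a ^ 4 + f₃ * a ^ 3 + f₂ * a ^ 2 + f₁ * a + f₀ ≠ 0)
    (h₂ : ∀ a b : ZMod q, ¬ (f₁ = a * (f₂ - b - a * (f₃ - a)) + b * (f₃ - a) ∧
      f₀ = b * (f₂ - b - a * (f₃ - a)))) :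
    Irreducible ((poly f₀ f₁ f₂ f₃).map (Int.castRingHom ℚ)) := by
  have := Fact.mk hq
  rw [show Int.castRingHom ℚ = algebraMap ℤ ℚ from rfl,
    ← monic_poly.irreducible_iff_irreducible_map_fraction_map]
  refine monic_poly.irreducible_of_irreducible_map (Int.castRingHom (ZMod q)) _ ?_
  have hmap : (poly f₀ f₁ f₂ f₃).map (Int.castRingHom (ZMod q)) =
      X ^ 4 + (C (f₃ : ZMod q) * X ^ 3 + C (f₂ : ZMod q) * X ^ 2 + C (f₁ : ZMod q) * X +
        C (f₀ : ZMod q)) := by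
    simp [poly]
  have hmon := (monic_poly (f₀ := f₀) (f₁ := f₁) (f₂ := f₂) (f₃ := f₃)).map
    (Int.castRingHom (ZMod q))
  have hdeg : ((poly f₀ f₁ f₂ f₃).map (Int.castRingHom (ZMod q))).natDegree = 4 := by
    rw [monic_poly.natDegree_map, natDegree_poly]
  rw [hmon.irreducible_iff_lt_natDegree_lt (by
    intro h
    rw [h] at hdeg
    simp at hdeg)]
  intro g hg hgd hdvd
  rw [hdeg, Finset.mem_Ioc] at hgd
  obtain ⟨k, hk⟩ := hdvd
  have hkm : k.Monic := hg.of_mul_monic_left (hk ▸ hmon)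
  have hdk : g.natDegree + k.natDegree = 4 := by
    rw [← hg.natDegree_mul hkm, ← hk, hdeg]
  obtain ⟨hg0, hg2⟩ := hgd
  have hc : ∀ n, (g * k).coeff n = ((poly f₀ f₁ f₂ f₃).map (Int.castRingHom (ZMod q))).coeff n :=
    fun n => by rw [hk]
  rcases (show g.natDegree = 1 ∨ g.natDegree = 2 by omega) with h | h
  · have hg' := hg.eq_X_add_C h
    apply h₁ (-g.coeff 0)
    have : ((poly f₀ f₁ f₂ f₃).map (Int.castRingHom (ZMod q))).eval (-g.coeff 0) = 0 := by
      rw [hk, eval_mul, hg']; simp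
    rw [hmap] at this
    simp only [eval_add, eval_mul, eval_pow, eval_X, eval_C] at this
    linear_combination this
  · have hquad : ∀ p : (ZMod q)[X], p.Monic → p.natDegree = 2 →
        p = X ^ 2 + C (p.coeff 1) * X + C (p.coeff 0) := by
      intro p hp hpd
      nth_rw 1 [p.as_sum_range_C_mul_X_pow, hpd]
      have : p.coeff 2 = 1 := by rw [← hpd]; exact hp
      simp [Finset.sum_range_succ, this]
      ring
    have hg' := hquad g hg h
    have hk' := hquad k hkm (by omega)
    set a := g.coeff 1
    set b := g.coeff 0
    set c := k.coeff 1
    set d := k.coeff 0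
    have hprod : g * k = X ^ 4 + (C (a + c) * X ^ 3 + C (b + d + a * c) * X ^ 2 +
        C (a * d + b * c) * X + C (b * d)) := by
      rw [hg', hk']
      simp only [C_add, C_mul]
      ring
    rw [hprod, hmap] at hc
    have e0 := hc 0
    have e1 := hc 1
    have e2 := hc 2
    have e3 := hc 3
    simp only [coeff_add, coeff_C_mul, coeff_X_pow, coeff_X, coeff_C] at e0 e1 e2 e3
    norm_num at e0 e1 e2 e3
    refine h₂ a b ⟨?_, ?_⟩
    · rw [← e1, ← e2, ← e3]; ring
    · rw [← e0, ← e2, ← e3]; ring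

end QuarticOrder

namespace QuarticOrder

variable {f₀ f₁ f₂ f₃ : ℤ}

/-- Some power, with exponent prime to `d`, of every unit lies in the group generated by
`-1, e₁, e₂` once this group has rank two and is saturated at the primes dividing `d`. -/
lemma exists_coprime_pow_eq {d : ℕ} {e₁ e₂ : (QuarticOrder f₀ f₁ f₂ f₃)ˣ}
    (htors : ∀ (τ : (QuarticOrder f₀ f₁ f₂ f₃)ˣ) (n : ℕ), n ≠ 0 → τ ^ n = 1 → τ = 1 ∨ τ = -1)
    (hind : ∀ a b : ℤ, e₁ ^ a * e₂ ^ b = 1 → a = 0 ∧ b = 0)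
    (hsat : ∀ ℓ, ℓ.Prime → ℓ ∣ d → Saturated ℓ e₁ e₂)
    (u : (QuarticOrder f₀ f₁ f₂ f₃)ˣ)
    (hdep : ∃ a b c : ℤ, ¬ (a = 0 ∧ b = 0 ∧ c = 0) ∧ u ^ a * e₁ ^ b * e₂ ^ c = 1) :
    ∃ (m : ℕ) (σ : (QuarticOrder f₀ f₁ f₂ f₃)ˣ) (A B : ℤ), m ≠ 0 ∧ m.Coprime d ∧
      (σ = 1 ∨ σ = -1) ∧ u ^ m = σ * (e₁ ^ A * e₂ ^ B) := by
  classical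
  have hex : ∃ m : ℕ, 0 < m ∧ ∃ (σ : (QuarticOrder f₀ f₁ f₂ f₃)ˣ) (A B : ℤ),
      (σ = 1 ∨ σ = -1) ∧ u ^ m = σ * (e₁ ^ A * e₂ ^ B) := by
    obtain ⟨a, b, c, h0, h⟩ := hdep
    have ha : a ≠ 0 := by
      rintro rfl
      rw [zpow_zero, one_mul] at h
      have := hind b c h
      tauto
    have h1 : u ^ a = e₁ ^ (-b) * e₂ ^ (-c) := by
      rw [zpow_neg, zpow_neg, ← mul_inv, eq_inv_iff_mul_eq_one, ← mul_assoc, h]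
    rcases a.natAbs_eq with h2 | h2
    · refine ⟨a.natAbs, by omega, 1, -b, -c, Or.inl rfl, ?_⟩
      rw [← zpow_natCast, ← h2, h1, one_mul]
    · refine ⟨a.natAbs, by omega, 1, b, c, Or.inl rfl, ?_⟩
      rw [← zpow_natCast, show ((a.natAbs : ℕ) : ℤ) = -a by omega, zpow_neg, h1, one_mul,
        zpow_neg, zpow_neg, ← mul_inv, inv_inv]
  obtain ⟨hpos, σ, A, B, hσ, h⟩ := Nat.find_spec hex
  refine ⟨Nat.find hex, σ, A, B, hpos.ne', ?_, hσ, h⟩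
  refine Nat.Coprime.symm (Nat.coprime_of_dvd fun ℓ hℓ hd hm => ?_)
  obtain ⟨k, hk⟩ := hm
  obtain ⟨⟨A', rfl⟩, ⟨B', rfl⟩⟩ := hsat ℓ hℓ hd (u ^ k) σ A B hσ (by
    rw [← h, hk, ← pow_mul, mul_comm])
  have hpow : (e₁ ^ A' * e₂ ^ B') ^ ℓ = e₁ ^ ((ℓ : ℤ) * A') * e₂ ^ ((ℓ : ℤ) * B') := by
    rw [mul_pow, ← zpow_natCast (e₁ ^ A'), ← zpow_natCast (e₂ ^ B'), ← zpow_mul, ← zpow_mul,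
      mul_comm A', mul_comm B']
  have hτ : (u ^ k * (e₁ ^ A' * e₂ ^ B')⁻¹) ^ (2 * ℓ) = 1 := by
    rw [mul_comm 2, pow_mul, mul_pow, ← pow_mul, mul_comm k, ← hk, h, inv_pow, hpow,
      mul_inv_cancel_right]
    rcases hσ with rfl | rfl <;> simp
  have h3 := htors _ _ (by have := hℓ.pos; omega) hτ
  have hk0 : 0 < k := by
    rcases Nat.eq_zero_or_pos k with rfl | h
    · omega
    · exact h
  refine Nat.find_min hex (m := k) ?_ ⟨hk0, _, A', B', h3, ?_⟩
  · rw [hk]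
    exact lt_mul_of_one_lt_left hk0 hℓ.one_lt
  · rw [inv_mul_cancel_right]

lemma charHom_eq_one {p d m : ℕ} [Fact p.Prime] {L : List (ℕ × ℕ)}
    (hL : IsCharacter f₀ f₁ f₂ f₃ p d L) {e₁ e₂ u σ : (QuarticOrder f₀ f₁ f₂ f₃)ˣ} {A B : ℤ}
    (hm : m.Coprime d) (hσ : σ = 1 ∨ σ = -1) (hu : u ^ m = σ * (e₁ ^ A * e₂ ^ B))
    (h : charNat p L (-1 : QuarticOrder f₀ f₁ f₂ f₃) = 1 ∧
      charNat p L (e₁ : QuarticOrder f₀ f₁ f₂ f₃) = 1 ∧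
      charNat p L (e₂ : QuarticOrder f₀ f₁ f₂ f₃) = 1) :
    charNat p L (u : QuarticOrder f₀ f₁ f₂ f₃) = 1 := by
  obtain ⟨h0, h1, h2⟩ := h
  let χ := Units.map (charHom hL)
  have hd : χ u ^ d = 1 := Units.ext (charHom_pow_eq_one hL u)
  have hσ' : χ σ = 1 := by
    rcases hσ with rfl | rfl
    · exact map_one _
    · exact Units.ext (charHom_eq_one_of_charNat hL h0)
  have he₁ : χ e₁ = 1 := Units.ext (charHom_eq_one_of_charNat hL h1)
  have he₂ : χ e₂ = 1 := Units.ext (charHom_eq_one_of_charNat hL h2)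
  have hm' : χ u ^ m = 1 := by
    rw [← map_pow, hu, map_mul, map_mul, map_zpow, map_zpow, hσ', he₁, he₂]; simp
  have : χ u = 1 := by
    have := pow_gcd_eq_one.2 ⟨hm', hd⟩
    rwa [hm.gcd_eq_one, pow_one] at this
  exact charNat_of_charHom_eq_one hL (congrArg Units.val this)

/-- The norm form of `P - Q x`. -/
def normForm (f₀ f₁ f₂ f₃ P Q : ℤ) : ℤ :=
  P ^ 4 + f₃ * P ^ 3 * Q + f₂ * P ^ 2 * Q ^ 2 + f₁ * P * Q ^ 3 + f₀ * Q ^ 4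

/-- The unit `P - Q x` attached to a solution of the Thue equation. -/
def linearUnit {P Q : ℤ} (h : normForm f₀ f₁ f₂ f₃ P Q = 1) : (QuarticOrder f₀ f₁ f₂ f₃)ˣ :=
  unitOfMul ⟨P, -Q, 0, 0⟩
    ⟨P ^ 3 + f₃ * P ^ 2 * Q + f₂ * P * Q ^ 2 + f₁ * Q ^ 3,
      P ^ 2 * Q + f₃ * P * Q ^ 2 + f₂ * Q ^ 3, P * Q ^ 2 + f₃ * Q ^ 3, Q ^ 3⟩ (by
    unfold normForm at h
    ext <;> simp only [mul_x₀, mul_x₁, mul_x₂, mul_x₃, c₄, c₅, c₆, one_x₀, one_x₁, one_x₂, one_x₃]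
    · linear_combination h
    · ring
    · ring
    · ring)

lemma linearUnit_val {P Q : ℤ} (h : normForm f₀ f₁ f₂ f₃ P Q = 1) :
    (linearUnit h : QuarticOrder f₀ f₁ f₂ f₃) = ⟨P, -Q, 0, 0⟩ := rfl

/-- The sieve: no residue class `t` modulo `p` is compatible with all the characters. -/
def Sieve (f₀ f₁ f₂ f₃ : ℤ) (p : ℕ) (S : List (List (ℕ × ℕ))) : Prop :=
  ∀ t ∈ List.range p,
    ¬ ((((t ^ 4 + f₃ * t ^ 3 + f₂ * t ^ 2 + f₁ * t + f₀) % p).toNat ^ ((p - 1) / Nat.gcd 4 (p - 1)))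
        % p = 1 ∧
      ∀ L ∈ S, charNat p L (⟨t, -1, 0, 0⟩ : QuarticOrder f₀ f₁ f₂ f₃) = 1)

instance (p : ℕ) (S : List (List (ℕ × ℕ))) : Decidable (Sieve f₀ f₁ f₂ f₃ p S) := by
  unfold Sieve; infer_instance

lemma dvd_of_sieve {p : ℕ} [hp : Fact p.Prime] {S : List (List (ℕ × ℕ))}
    (hS : Sieve f₀ f₁ f₂ f₃ p S) (hdeg : ∀ L ∈ S, p - 1 ∣ (L.map Prod.snd).sum)
    {P Q : ℤ} (hPQ : normForm f₀ f₁ f₂ f₃ P Q = 1)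
    (hu : ∀ L ∈ S, charNat p L (⟨P, -Q, 0, 0⟩ : QuarticOrder f₀ f₁ f₂ f₃) = 1) : (p : ℤ) ∣ Q := by
  by_contra hQ
  have hQ' : (Q : ZMod p) ≠ 0 := fun h => hQ ((ZMod.intCast_zmod_eq_zero_iff_dvd _ _).1 h)
  set t : ZMod p := P / Q with ht
  have hPt : (P : ZMod p) = t * Q := by rw [ht, div_mul_cancel₀ _ hQ']
  have htv : ((t.val : ℕ) : ZMod p) = t := ZMod.natCast_zmod_val t
  have hp1 : 1 < p := hp.out.one_lt
  refine hS t.val (List.mem_range.2 (ZMod.val_lt t)) ⟨?_, ?_⟩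
  · have hn : (t ^ 4 + f₃ * t ^ 3 + f₂ * t ^ 2 + f₁ * t + f₀) * (Q : ZMod p) ^ 4 = 1 := by
      have := congrArg (Int.cast : ℤ → ZMod p) hPQ
      unfold normForm at this
      push_cast at this
      rw [hPt] at this
      linear_combination this
    obtain ⟨g, hg⟩ : Nat.gcd 4 (p - 1) ∣ 4 := Nat.gcd_dvd_left _ _
    obtain ⟨k, hk⟩ : Nat.gcd 4 (p - 1) ∣ p - 1 := Nat.gcd_dvd_right _ _
    have hg0 : 0 < Nat.gcd 4 (p - 1) := Nat.gcd_pos_of_pos_left _ (by norm_num)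
    have hdiv : (p - 1) / Nat.gcd 4 (p - 1) = k := by
      nth_rw 1 [hk]
      exact Nat.mul_div_cancel_left _ hg0
    have h1 : (t ^ 4 + f₃ * t ^ 3 + f₂ * t ^ 2 + f₁ * t + f₀) ^ k = 1 := by
      have h4 : ((Q : ZMod p) ^ 4) ^ k = 1 := by
        rw [← pow_mul, show 4 * k = (p - 1) * g by
          nth_rw 1 [hg]; nth_rw 2 [hk]; ring, pow_mul, ZMod.pow_card_sub_one_eq_one hQ', one_pow]
      have := congrArg (· ^ k) hn
      simpa [mul_pow, h4] using this
    rw [hdiv]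
    have h2 : (((((t.val : ℤ) ^ 4 + f₃ * (t.val : ℤ) ^ 3 + f₂ * (t.val : ℤ) ^ 2 + f₁ * (t.val : ℤ) + f₀)
        % p).toNat ^ k : ℕ) : ZMod p) = (1 : ℕ) := by
      rw [Nat.cast_pow, toNat_emod_cast]
      push_cast
      rw [htv, h1]
    rw [ZMod.natCast_eq_natCast_iff', Nat.mod_eq_of_lt hp1] at h2
    exact h2
  · intro L hL
    have h1 := hu L hL
    have h2 : charVal p L (⟨P, -Q, 0, 0⟩ : QuarticOrder f₀ f₁ f₂ f₃) =
        charVal p L (⟨t.val, -1, 0, 0⟩ : QuarticOrder f₀ f₁ f₂ f₃) := by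
      obtain ⟨k, hk⟩ := hdeg L hL
      have hq : (Q : ZMod p) ^ (L.map Prod.snd).sum = 1 := by
        rw [hk, pow_mul, ZMod.pow_card_sub_one_eq_one hQ', one_pow]
      rw [← mul_one (charVal p L (⟨t.val, -1, 0, 0⟩ : QuarticOrder f₀ f₁ f₂ f₃)), ← hq]
      unfold charVal
      clear * - hPt htv
      induction L with
      | nil => simp
      | cons z L ih =>
        simp only [List.map_cons, List.prod_cons, List.sum_cons, pow_add]
        rw [ih]
        have : ((P : ℤ) : ZMod p) + ((-Q : ℤ) : ZMod p) * z.1 + ((0 : ℤ) : ZMod p) * z.1 ^ 2 +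
          ((0 : ℤ) : ZMod p) * z.1 ^ 3 = (((t.val : ℤ) : ZMod p) + ((-1 : ℤ) : ZMod p) * z.1 +
          ((0 : ℤ) : ZMod p) * z.1 ^ 2 + ((0 : ℤ) : ZMod p) * z.1 ^ 3) * Q := by
          push_cast
          rw [hPt, htv]
          ring
        rw [this, mul_pow]
        ring
    rw [← charNat_cast, ← charNat_cast, h1, ZMod.natCast_eq_natCast_iff', Nat.mod_eq_of_lt hp1] at h2
    have h3 := h2.symm
    rw [charNat, Nat.mod_mod] at h3
    exact h3

/-- The data of a power of `e` congruent to `1` modulo `p`. -/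
lemma exists_pow_eq_one_add {p : ℕ} {e E : QuarticOrder f₀ f₁ f₂ f₃}
    (h : powMod (p ^ 2 : ℕ) e (p - 1) = 1 + p * E) :
    ∃ k, e ^ (p - 1) = 1 + p * (E + p * k) := by
  obtain ⟨k, hk⟩ := exists_pow_eq_powMod_add ((p ^ 2 : ℕ) : ℤ) e (p - 1)
  refine ⟨k, ?_⟩
  rw [hk, h]
  push_cast
  ring

lemma exists_units_pow_eq {p : ℕ} {e₁ e₂ : (QuarticOrder f₀ f₁ f₂ f₃)ˣ}
    {E₁ E₂ : QuarticOrder f₀ f₁ f₂ f₃}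
    (hE₁ : powMod (p ^ 2 : ℕ) (e₁ : QuarticOrder f₀ f₁ f₂ f₃) (p - 1) = 1 + p * E₁)
    (hE₂ : powMod (p ^ 2 : ℕ) (e₂ : QuarticOrder f₀ f₁ f₂ f₃) (p - 1) = 1 + p * E₂)
    (hd : ¬ (p : ℤ) ∣ E₁.x₂ * E₂.x₃ - E₁.x₃ * E₂.x₂) :
    ∃ F₁ F₂ : QuarticOrder f₀ f₁ f₂ f₃,
      ((e₁ ^ (p - 1) : (QuarticOrder f₀ f₁ f₂ f₃)ˣ) : QuarticOrder f₀ f₁ f₂ f₃) = 1 + p * F₁ ∧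
      ((e₂ ^ (p - 1) : (QuarticOrder f₀ f₁ f₂ f₃)ˣ) : QuarticOrder f₀ f₁ f₂ f₃) = 1 + p * F₂ ∧
      ¬ (p : ℤ) ∣ F₁.x₂ * F₂.x₃ - F₁.x₃ * F₂.x₂ := by
  obtain ⟨k₁, h₁⟩ := exists_pow_eq_one_add hE₁
  obtain ⟨k₂, h₂⟩ := exists_pow_eq_one_add hE₂
  refine ⟨_, _, by rw [Units.val_pow_eq_pow_val, h₁], by rw [Units.val_pow_eq_pow_val, h₂], ?_⟩
  intro h
  apply hd
  have e : ∀ k : QuarticOrder f₀ f₁ f₂ f₃, (p : QuarticOrder f₀ f₁ f₂ f₃) * k =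
      ⟨p * k.x₀, p * k.x₁, p * k.x₂, p * k.x₃⟩ := fun k => by
    rw [← intCast_mul, Int.cast_natCast]
  rw [e, e] at h
  simp only [add_x₂, add_x₃] at h
  obtain ⟨c, hc⟩ := h
  exact ⟨c - (E₁.x₂ * k₂.x₃ + k₁.x₂ * E₂.x₃ + p * k₁.x₂ * k₂.x₃ - E₁.x₃ * k₂.x₂ - k₁.x₃ * E₂.x₂
    - p * k₁.x₃ * k₂.x₂), by linear_combination hc⟩

/-- Independence of two units, certified modulo the square of a prime. -/
lemma independent_of_powMod {p : ℕ} (hp : p.Prime) (hp2 : 2 < p)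
    {e₁ e₂ : (QuarticOrder f₀ f₁ f₂ f₃)ˣ} {E₁ E₂ : QuarticOrder f₀ f₁ f₂ f₃}
    (hE₁ : powMod (p ^ 2 : ℕ) (e₁ : QuarticOrder f₀ f₁ f₂ f₃) (p - 1) = 1 + p * E₁)
    (hE₂ : powMod (p ^ 2 : ℕ) (e₂ : QuarticOrder f₀ f₁ f₂ f₃) (p - 1) = 1 + p * E₂)
    (hd : ¬ (p : ℤ) ∣ E₁.x₂ * E₂.x₃ - E₁.x₃ * E₂.x₂) (a b : ℤ) (h : e₁ ^ a * e₂ ^ b = 1) :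
    a = 0 ∧ b = 0 := by
  obtain ⟨F₁, F₂, h₁, h₂, h₃⟩ := exists_units_pow_eq hE₁ hE₂ hd
  refine eq_zero_of_zpow_mul_zpow_eq_one hp hp2 _ _ F₁ F₂ h₁ h₂ h₃ a b ?_
  rw [← zpow_natCast, ← zpow_natCast, zpow_comm, zpow_comm e₂, ← mul_zpow, h, one_zpow]

lemma exists_coprime_pow_eq_of_irreducible {d : ℕ}
    [Fact (Irreducible ((poly f₀ f₁ f₂ f₃).map (Int.castRingHom ℚ)))]
    (hdisc : 4 * (12 * f₀ - 3 * f₃ * f₁ + f₂ ^ 2) ^ 3 <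
      (72 * f₂ * f₀ + 9 * f₃ * f₂ * f₁ - 27 * f₁ ^ 2 - 27 * f₀ * f₃ ^ 2 - 2 * f₂ ^ 3) ^ 2)
    {t T : ℤ} (ht : t ^ 4 + f₃ * t ^ 3 + f₂ * t ^ 2 + f₁ * t + f₀ ≤ 0)
    (hT : 0 ≤ T ^ 4 + f₃ * T ^ 3 + f₂ * T ^ 2 + f₁ * T + f₀)
    {e₁ e₂ : (QuarticOrder f₀ f₁ f₂ f₃)ˣ}
    (hind : ∀ a b : ℤ, e₁ ^ a * e₂ ^ b = 1 → a = 0 ∧ b = 0)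
    (hsat : ∀ ℓ, ℓ.Prime → ℓ ∣ d → Saturated ℓ e₁ e₂) (u : (QuarticOrder f₀ f₁ f₂ f₃)ˣ) :
    ∃ (m : ℕ) (σ : (QuarticOrder f₀ f₁ f₂ f₃)ˣ) (A B : ℤ), m ≠ 0 ∧ m.Coprime d ∧
      (σ = 1 ∨ σ = -1) ∧ u ^ m = σ * (e₁ ^ A * e₂ ^ B) := by
  obtain ⟨r, hr⟩ := exists_real_root ht hT
  obtain ⟨w, hw, him⟩ := Complex.exists_quartic_root_im_pos f₃ f₂ f₁ f₀ (by exact_mod_cast hdisc)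
  refine exists_coprime_pow_eq (fun τ n hn h => ?_) hind hsat u
    (exists_zpow_mul_zpow_mul_zpow_eq_one w (by simpa using hw) him u e₁ e₂)
  rcases eq_one_or_eq_neg_one_of_pow_eq_one r hr (τ : QuarticOrder f₀ f₁ f₂ f₃) hn
    (by rw [← Units.val_pow_eq_pow_val, h, Units.val_one]) with h | h
  · exact Or.inl (Units.ext h)
  · exact Or.inr (Units.ext h)

/-- Resolution of a quartic Thue equation of mixed signature by a sieve and Skolem's method. -/
theorem eq_zero_of_normForm_eq_one {p d : ℕ} [hp : Fact p.Prime] (hp2 : 2 < p)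
    [Fact (Irreducible ((poly f₀ f₁ f₂ f₃).map (Int.castRingHom ℚ)))]
    (hdisc : 4 * (12 * f₀ - 3 * f₃ * f₁ + f₂ ^ 2) ^ 3 <
      (72 * f₂ * f₀ + 9 * f₃ * f₂ * f₁ - 27 * f₁ ^ 2 - 27 * f₀ * f₃ ^ 2 - 2 * f₂ ^ 3) ^ 2)
    {t T : ℤ} (ht : t ^ 4 + f₃ * t ^ 3 + f₂ * t ^ 2 + f₁ * t + f₀ ≤ 0)
    (hT : 0 ≤ T ^ 4 + f₃ * T ^ 3 + f₂ * T ^ 2 + f₁ * T + f₀)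
    {e₁ e₂ : (QuarticOrder f₀ f₁ f₂ f₃)ˣ} {E₁ E₂ : QuarticOrder f₀ f₁ f₂ f₃}
    (hE₁ : powMod (p ^ 2 : ℕ) (e₁ : QuarticOrder f₀ f₁ f₂ f₃) (p - 1) = 1 + p * E₁)
    (hE₂ : powMod (p ^ 2 : ℕ) (e₂ : QuarticOrder f₀ f₁ f₂ f₃) (p - 1) = 1 + p * E₂)
    (hd : ¬ (p : ℤ) ∣ E₁.x₂ * E₂.x₃ - E₁.x₃ * E₂.x₂)
    (hsat : ∀ ℓ, ℓ.Prime → ℓ ∣ d → Saturated ℓ e₁ e₂)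
    (S : List (List (ℕ × ℕ)))
    (hchar : ∀ L ∈ S, IsCharacter f₀ f₁ f₂ f₃ p d L ∧ p - 1 ∣ (L.map Prod.snd).sum ∧
      charNat p L (-1 : QuarticOrder f₀ f₁ f₂ f₃) = 1 ∧
      charNat p L (e₁ : QuarticOrder f₀ f₁ f₂ f₃) = 1 ∧
      charNat p L (e₂ : QuarticOrder f₀ f₁ f₂ f₃) = 1)
    (hS : Sieve f₀ f₁ f₂ f₃ p S) {P Q : ℤ} (hPQ : normForm f₀ f₁ f₂ f₃ P Q = 1) : Q = 0 := by
  obtain ⟨m, σ, A, B, hm0, hm, hσ, hu⟩ := exists_coprime_pow_eq_of_irreducible hdisc ht hT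
    (independent_of_powMod hp.out hp2 hE₁ hE₂ hd) hsat (linearUnit hPQ)
  have hQ : (p : ℤ) ∣ Q := by
    refine dvd_of_sieve hS (fun L hL => (hchar L hL).2.1) hPQ fun L hL => ?_
    obtain ⟨h1, -, h2⟩ := hchar L hL
    have h3 := charHom_eq_one h1 hm hσ hu h2
    rwa [linearUnit_val] at h3
  have hP : ¬ (p : ℤ) ∣ P := by
    intro hP
    have : (p : ℤ) ∣ 1 := by
      rw [← hPQ]
      obtain ⟨P, rfl⟩ := hP
      obtain ⟨Q, rfl⟩ := hQ
      exact ⟨p ^ 3 * normForm f₀ f₁ f₂ f₃ P Q, by unfold normForm; ring⟩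
    exact hp.out.one_lt.ne' (by exact_mod_cast Int.eq_one_of_dvd_one (by positivity) this)
  obtain ⟨F₁, F₂, h₁, h₂, h₃⟩ := exists_units_pow_eq hE₁ hE₂ hd
  have hodd : Even (p - 1) := hp.out.even_sub_one (by omega)
  have hσ1 : σ ^ (p - 1) = 1 := by
    rcases hσ with rfl | rfl
    · exact one_pow _
    · exact hodd.neg_one_pow
  refine eq_zero_of_pow_eq_zpow_mul_zpow hp.out hp2 _ _ F₁ F₂ h₁ h₂ h₃ A B hQ hP
    (n := m * (p - 1)) (mul_ne_zero hm0 (by omega)) ?_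
  rw [← linearUnit_val hPQ, ← Units.val_pow_eq_pow_val, pow_mul, hu, mul_pow, hσ1, one_mul, mul_pow,
    ← zpow_natCast, ← zpow_natCast, ← zpow_natCast (e₁ ^ A), ← zpow_natCast (e₂ ^ B), zpow_comm,
    zpow_comm e₂]

end QuarticOrder

namespace QuarticOrder

lemma forall_prime_dvd {d : ℕ} (L : List ℕ) (hd : d ∣ L.prod ^ 3) (hL : ∀ q ∈ L, q.Prime)
    {C : ℕ → Prop} (h : ∀ ℓ ∈ L, C ℓ) (ℓ : ℕ) (hℓ : ℓ.Prime) (hℓd : ℓ ∣ d) : C ℓ := by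
  have h1 : ℓ ∣ L.prod := hℓ.dvd_of_dvd_pow (hℓd.trans hd)
  exact h ℓ (mem_list_primes_of_dvd_prod hℓ.prime (fun q hq => (hL q hq).prime) h1)

lemma eq_zero_of_normForm_neg64_neg276_16_4 {P Q : ℤ} (h : normForm (-64) (-276) 16 4 P Q = 1) :
  Q = 0 := by
  have : Fact (Nat.Prime 283) := ⟨by norm_num⟩
  have : Fact (Nat.Prime 659) := ⟨by norm_num⟩
  have : Fact (Irreducible ((poly (-64) (-276) 16 4).map (Int.castRingHom ℚ))) :=
    ⟨irreducible_of_zmod (q := 19) (by norm_num) (by decide +kernel) (by decide +kernel)⟩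
  refine eq_zero_of_normForm_eq_one (p := 659) (d := 94) (t := 0) (T := 1000)
    (e₁ := unitOfMul ⟨2327936690109, -126085386968, -31412112268, -8329935124⟩
      ⟨24505565870115584782229, 110705371484668670118232, 16574885133989506541804,
        1867253038172551047604⟩ (by decide +kernel))
    (e₂ := unitOfMul ⟨2849690203282088510269673, -154344434331001486672491,
      -38452419413935684630961, -10196898225855233048605⟩
      ⟨-18010159722045370087, -76424414554367971961, 9995506302923681686, 1319240937294670138⟩
        (by decide +kernel))
    (E₁ := ⟨57, 160, 492, 323⟩) (E₂ := ⟨608, 226, 599, 36⟩)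
    (by norm_num) (by norm_num) (by norm_num) (by norm_num) (by decide +kernel) (by decide +kernel)
    (by decide +kernel) (forall_prime_dvd [2, 47] (by norm_num) (by norm_num) ?_)
    [[(240, 245), (278, 350), (301, 308), (495, 413)], [(240, 329), (278, 0), (301, 329), (495,
      0)], [(240, 329), (278, 329), (301, 0), (495, 0)]] (by decide +kernel) (by decide +kernel) h
  simp only [List.forall_mem_cons, List.not_mem_nil, false_imp_iff, implies_true, and_true]
  constructor
  · exact saturated_of_powersAvoid (M := 4) (T := [⟨1, 5, 7, 3⟩, ⟨7, 3, 1, 5⟩, ⟨5, 0, 4, 4⟩, ⟨3, 0,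
    4, 4⟩, ⟨5, 1, 7, 7⟩, ⟨3, 7, 1, 1⟩]) (by norm_num) (by norm_num) (by norm_num)
      (by decide +kernel) (by decide +kernel)
  · exact saturated_of_characters (q := 283) (L := [(256, 144), (219, 6)])
      (M := [(256, 162), (219, 144)]) (by norm_num) (by decide +kernel)
      (by decide +kernel) (by decide +kernel)

lemma eq_zero_of_normForm_16_12_4_neg72 {P Q : ℤ} (h : normForm 16 12 4 (-72) P Q = 1) : Q = 0 := by
  have : Fact (Nat.Prime 127) := ⟨by norm_num⟩
  have : Fact (Nat.Prime 283) := ⟨by norm_num⟩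
  have : Fact (Nat.Prime 659) := ⟨by norm_num⟩
  have : Fact (Irreducible ((poly 16 12 4 (-72)).map (Int.castRingHom ℚ))) :=
    ⟨irreducible_of_zmod (q := 19) (by norm_num) (by decide +kernel) (by decide +kernel)⟩
  refine eq_zero_of_normForm_eq_one (p := 659) (d := 329) (t := 1) (T := 1000)
    (e₁ := unitOfMul ⟨-451422991265, -964528346119, -1450309175701, 20346982841⟩
      ⟨-90385, 38803, 121204, -1692⟩ (by decide +kernel))
    (e₂ := unitOfMul ⟨43586634089287975, 3170585042064507, -89101822273093812, 1237792696591668⟩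
      ⟨5840872820007075888704494232349480164071, 4461843207499440469515319109561251984257,
        1522238177206188756662952036940176067995, -26262768459407118498015408196940977352799⟩
        (by decide +kernel))
    (E₁ := ⟨8, 302, 452, 142⟩) (E₂ := ⟨145, 219, 437, 246⟩)
    (by norm_num) (by norm_num) (by norm_num) (by norm_num) (by decide +kernel) (by decide +kernel)
    (by decide +kernel) (forall_prime_dvd [7, 47] (by norm_num) (by norm_num) ?_)
    [[(156, 338), (255, 202), (350, 38), (629, 80)]] (by decide +kernel) (by decide +kernel) h
  simp only [List.forall_mem_cons, List.not_mem_nil, false_imp_iff, implies_true, and_true]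
  constructor
  · exact saturated_of_characters (q := 127) (L := [(117, 72), (94, 0)])
      (M := [(117, 54), (94, 108)]) (by norm_num) (by decide +kernel)
      (by decide +kernel) (by decide +kernel)
  · exact saturated_of_characters (q := 283) (L := [(196, 138), (185, 180)])
      (M := [(196, 132), (185, 96)]) (by norm_num) (by decide +kernel)
      (by decide +kernel) (by decide +kernel)

lemma eq_zero_of_normForm_25_0_neg50_60 {P Q : ℤ} (h : normForm 25 0 (-50) 60 P Q = 1) : Q = 0 := by
  have : Fact (Nat.Prime 41) := ⟨by norm_num⟩
  have : Fact (Irreducible ((poly 25 0 (-50) 60).map (Int.castRingHom ℚ))) :=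
    ⟨irreducible_of_zmod (q := 13) (by norm_num) (by decide +kernel) (by decide +kernel)⟩
  refine eq_zero_of_normForm_eq_one (p := 41) (d := 5) (t := -60) (T := 1000)
    (e₁ := unitOfMul ⟨-4407986, -3074339, 9070898, 149950⟩
      ⟨1277234, -2322916, 1670146, 28023⟩ (by decide +kernel))
    (e₂ := unitOfMul ⟨1954560109430681066, -3554696060184724334, 2555692001200440454,
      42988825561408465⟩
      ⟨-5608899728296214, 92218331878439, 11216283255350402, -13645771083151308⟩
        (by decide +kernel))
    (E₁ := ⟨36, 16, 29, 35⟩) (E₂ := ⟨24, 10, 27, 19⟩)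
    (by norm_num) (by norm_num) (by norm_num) (by norm_num) (by decide +kernel) (by decide +kernel)
    (by decide +kernel) (forall_prime_dvd [5] (by norm_num) (by norm_num) ?_)
    [[(4, 0), (15, 0), (16, 8), (28, 32)], [(4, 8), (15, 8), (16, 0), (28, 24)]]
      (by decide +kernel) (by decide +kernel) h
  simp only [List.forall_mem_cons, List.not_mem_nil, false_imp_iff, implies_true, and_true]
  exact saturated_of_powersAvoid (M := 5) (T := [⟨16, 16, 4, 15⟩, ⟨9, 9, 21, 10⟩, ⟨6, 12, 9, 23⟩,
    ⟨19, 13, 16, 2⟩, ⟨21, 13, 10, 10⟩, ⟨4, 12, 15, 15⟩, ⟨11, 19, 2, 12⟩, ⟨14, 6, 23, 13⟩, ⟨14, 11,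
    23, 0⟩, ⟨11, 14, 2, 0⟩, ⟨24, 0, 0, 2⟩, ⟨1, 0, 0, 23⟩, ⟨9, 9, 21, 22⟩, ⟨16, 16, 4, 3⟩, ⟨19, 13,
    16, 24⟩, ⟨6, 12, 9, 1⟩, ⟨4, 12, 15, 22⟩, ⟨21, 13, 10, 3⟩, ⟨21, 8, 15, 16⟩, ⟨4, 17, 10, 9⟩, ⟨11,
    14, 2, 8⟩, ⟨14, 11, 23, 17⟩, ⟨1, 0, 0, 21⟩, ⟨24, 0, 0, 4⟩, ⟨16, 16, 4, 16⟩, ⟨9, 9, 21, 9⟩, ⟨6,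
    12, 9, 4⟩, ⟨19, 13, 16, 21⟩, ⟨19, 18, 6, 13⟩, ⟨6, 7, 19, 12⟩, ⟨4, 17, 10, 16⟩, ⟨21, 8, 15, 9⟩,
    ⟨14, 11, 23, 9⟩, ⟨11, 14, 2, 16⟩, ⟨24, 0, 0, 6⟩, ⟨1, 0, 0, 19⟩, ⟨9, 9, 21, 21⟩, ⟨16, 16, 4, 4⟩,
    ⟨16, 11, 19, 2⟩, ⟨9, 14, 6, 23⟩, ⟨6, 7, 19, 15⟩, ⟨19, 18, 6, 10⟩, ⟨21, 8, 15, 2⟩, ⟨4, 17, 10,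
    23⟩, ⟨11, 14, 2, 24⟩, ⟨14, 11, 23, 1⟩, ⟨1, 0, 0, 17⟩, ⟨24, 0, 0, 8⟩]) (by norm_num) (by
    norm_num) (by norm_num)
    (by decide +kernel) (by decide +kernel)

lemma eq_zero_of_normForm_25_300_neg50_0 {P Q : ℤ} (h : normForm 25 300 (-50) 0 P Q = 1) : Q = 0 :=
  by
  have : Fact (Nat.Prime 59) := ⟨by norm_num⟩
  have : Fact (Nat.Prime 233) := ⟨by norm_num⟩
  have : Fact (Irreducible ((poly 25 300 (-50) 0).map (Int.castRingHom ℚ))) :=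
    ⟨irreducible_of_zmod (q := 13) (by norm_num) (by decide +kernel) (by decide +kernel)⟩
  refine eq_zero_of_normForm_eq_one (p := 233) (d := 29) (t := -9) (T := 1000)
    (e₁ := unitOfMul ⟨-1, -12, 2, 0⟩
      ⟨540099, -88788, -146, 1776⟩ (by decide +kernel))
    (e₂ := unitOfMul ⟨-622327225415400122905708906618927243693474,
      -7399489013029421972393202289803020871393315, 2058380620954404810297329773640804720556850,
      -226361330680607473765021128437861912451086⟩
      ⟨1239227854403527545772726, 15094658971526838644605440, 233022722184838630968350,
        -155273984296655195803889⟩ (by decide +kernel))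
    (E₁ := ⟨114, 188, 219, 146⟩) (E₂ := ⟨101, 77, 184, 24⟩)
    (by norm_num) (by norm_num) (by norm_num) (by norm_num) (by decide +kernel) (by decide +kernel)
    (by decide +kernel) (forall_prime_dvd [29] (by norm_num) (by norm_num) ?_)
    [[(36, 184), (108, 80), (155, 168), (167, 32)]] (by decide +kernel) (by decide +kernel) h
  simp only [List.forall_mem_cons, List.not_mem_nil, false_imp_iff, implies_true, and_true]
  exact saturated_of_characters (q := 59) (L := [(52, 40), (20, 54)])
    (M := [(52, 2), (20, 26)]) (by norm_num) (by decide +kernel)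
    (by decide +kernel) (by decide +kernel)

lemma eq_zero_of_normForm_36_12_64_48 {P Q : ℤ} (h : normForm 36 12 64 48 P Q = 1) : Q = 0 := by
  have : Fact (Nat.Prime 227) := ⟨by norm_num⟩
  have : Fact (Irreducible ((poly 36 12 64 48).map (Int.castRingHom ℚ))) :=
    ⟨irreducible_of_zmod (q := 13) (by norm_num) (by decide +kernel) (by decide +kernel)⟩
  refine eq_zero_of_normForm_eq_one (p := 227) (d := 113) (t := -46) (T := 1000)
    (e₁ := unitOfMul ⟨8209372222256587, -2603666855791081, 16288101844044287, 350562963216287⟩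
      ⟨-771768319332812585, -240706180958176919, -1366870825170583912, -999713025271235912⟩
        (by decide +kernel))
    (e₂ := unitOfMul ⟨654341622256231978855, -207529723649702999383, 1298270207080145413436,
      27941922117024497012⟩
      ⟨152889680233652172235, -273171013875538269641, -250449814469066962069, -5243560658993650661⟩
        (by decide +kernel))
    (E₁ := ⟨146, 94, 100, 194⟩) (E₂ := ⟨74, 125, 95, 197⟩)
    (by norm_num) (by norm_num) (by norm_num) (by norm_num) (by decide +kernel) (by decide +kernel)
    (by decide +kernel) (forall_prime_dvd [113] (by norm_num) (by norm_num) ?_)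
    [[(16, 42), (97, 20), (104, 78), (189, 86)]] (by decide +kernel) (by decide +kernel) h
  simp only [List.forall_mem_cons, List.not_mem_nil, false_imp_iff, implies_true, and_true]
  exact saturated_of_characters (q := 227) (L := [(97, 136), (16, 40)])
    (M := [(97, 188), (16, 32)]) (by norm_num) (by decide +kernel)
    (by decide +kernel) (by decide +kernel)

lemma eq_zero_of_normForm_81_12_neg26_neg32 {P Q : ℤ} (h : normForm 81 12 (-26) (-32) P Q = 1) :
  Q = 0 := by
  have : Fact (Nat.Prime 79) := ⟨by norm_num⟩
  have : Fact (Nat.Prime 937) := ⟨by norm_num⟩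
  have : Fact (Irreducible ((poly 81 12 (-26) (-32)).map (Int.castRingHom ℚ))) :=
    ⟨irreducible_of_zmod (q := 13) (by norm_num) (by decide +kernel) (by decide +kernel)⟩
  refine eq_zero_of_normForm_eq_one (p := 937) (d := 104) (t := 2) (T := 1000)
    (e₁ := unitOfMul ⟨40, -34, 1, 0⟩
      ⟨-2, -2, -1, 0⟩ (by decide +kernel))
    (e₂ := unitOfMul ⟨18852045104569511122970508164768680674319226088994228,
      18174917093588416877707701097610045121660967681949364,
      8778256128231315237029785220242884764062585949627868,
      -285245306241553529305490756477042596740944801932989⟩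
      ⟨-588641674050146408036084, -105163677040044012067263, 185738515559252246683896,
        238216062588605824744014⟩ (by decide +kernel))
    (E₁ := ⟨601, 278, 796, 159⟩) (E₂ := ⟨130, 814, 296, 546⟩)
    (by norm_num) (by norm_num) (by norm_num) (by norm_num) (by decide +kernel) (by decide +kernel)
    (by decide +kernel) (forall_prime_dvd [2, 13] (by norm_num) (by norm_num) ?_)
    [[(224, 54), (282, 288), (503, 189), (897, 405)], [(224, 234), (282, 0), (503, 117), (897,
      585)], [(224, 585), (282, 117), (503, 0), (897, 234)]] (by decide +kernel)
      (by decide +kernel) h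
  simp only [List.forall_mem_cons, List.not_mem_nil, false_imp_iff, implies_true, and_true]
  constructor
  · exact saturated_of_powersAvoid (M := 2) (T := [⟨0, 0, 0, 3⟩, ⟨0, 0, 0, 1⟩, ⟨0, 2, 1, 0⟩, ⟨0, 2,
    3, 0⟩, ⟨2, 1, 0, 2⟩, ⟨2, 3, 0, 2⟩]) (by norm_num) (by norm_num) (by norm_num)
      (by decide +kernel) (by decide +kernel)
  · exact saturated_of_characters (q := 79) (L := [(68, 12), (6, 42)])
      (M := [(68, 24), (6, 30)]) (by norm_num) (by decide +kernel)
      (by decide +kernel) (by decide +kernel)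

lemma eq_zero_of_normForm_100_300_40_0 {P Q : ℤ} (h : normForm 100 300 40 0 P Q = 1) : Q = 0 := by
  have : Fact (Nat.Prime 79) := ⟨by norm_num⟩
  have : Fact (Nat.Prime 937) := ⟨by norm_num⟩
  have : Fact (Irreducible ((poly 100 300 40 0).map (Int.castRingHom ℚ))) :=
    ⟨irreducible_of_zmod (q := 13) (by norm_num) (by decide +kernel) (by decide +kernel)⟩
  refine eq_zero_of_normForm_eq_one (p := 937) (d := 104) (t := -4) (T := 1000)
    (e₁ := unitOfMul ⟨-8987251944113061061, -24994626367485769217, 1875922372326632465,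
      -410601838618602793⟩
      ⟨7077759, 1008377, -42914, 16516⟩ (by decide +kernel))
    (e₂ := unitOfMul ⟨-19857688377239142744379833, -2786084082011191432818718,
      24282226807174282206004, -69439822367450615647424⟩
      ⟨-3485863847497, -15532555839938, -16962325200088, -3005126185240⟩ (by decide +kernel))
    (E₁ := ⟨707, 97, 566, 261⟩) (E₂ := ⟨831, 568, 758, 840⟩)
    (by norm_num) (by norm_num) (by norm_num) (by norm_num) (by decide +kernel) (by decide +kernel)
    (by decide +kernel) (forall_prime_dvd [2, 13] (by norm_num) (by norm_num) ?_)
    [[(496, 369), (711, 72), (759, 189), (845, 306)], [(496, 117), (711, 0), (759, 117), (845,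
      702)], [(496, 702), (711, 117), (759, 0), (845, 117)]] (by decide +kernel)
      (by decide +kernel) h
  simp only [List.forall_mem_cons, List.not_mem_nil, false_imp_iff, implies_true, and_true]
  constructor
  · exact saturated_of_powersAvoid (M := 2) (T := [⟨3, 2, 0, 0⟩, ⟨1, 2, 0, 0⟩, ⟨3, 3, 1, 3⟩, ⟨1, 1,
    3, 1⟩, ⟨1, 3, 1, 3⟩, ⟨3, 1, 3, 1⟩]) (by norm_num) (by norm_num) (by norm_num)
      (by decide +kernel) (by decide +kernel)
  · exact saturated_of_characters (q := 79) (L := [(66, 36), (46, 0)])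
      (M := [(66, 12), (46, 24)]) (by norm_num) (by decide +kernel)
      (by decide +kernel) (by decide +kernel)

lemma eq_zero_of_normForm_121_168_neg86_12 {P Q : ℤ} (h : normForm 121 168 (-86) 12 P Q = 1) :
  Q = 0 := by
  have : Fact (Nat.Prime 719) := ⟨by norm_num⟩
  have : Fact (Irreducible ((poly 121 168 (-86) 12).map (Int.castRingHom ℚ))) :=
    ⟨irreducible_of_zmod (q := 19) (by norm_num) (by decide +kernel) (by decide +kernel)⟩
  refine eq_zero_of_normForm_eq_one (p := 719) (d := 359) (t := -17) (T := 1000)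
    (e₁ := unitOfMul ⟨-481205964755, -640555181672, 378711636932, -69418912800⟩
      ⟨-4402556971, -7795088344, 338390332, 44141600⟩ (by decide +kernel))
    (e₂ := unitOfMul ⟨165152997697140835816973442850, -69621471436934694044811585931,
      8632500688739552510160756682, 754094188782004170165844390⟩
      ⟨-194703073569102, -259177255925240, 153231928432022, -28087852375105⟩ (by decide +kernel))
    (E₁ := ⟨684, 12, 123, 628⟩) (E₂ := ⟨647, 122, 499, 46⟩)
    (by norm_num) (by norm_num) (by norm_num) (by norm_num) (by decide +kernel) (by decide +kernel)
    (by decide +kernel) (forall_prime_dvd [359] (by norm_num) (by norm_num) ?_)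
    [[(344, 440), (527, 330), (611, 678), (663, 706)]] (by decide +kernel) (by decide +kernel) h
  simp only [List.forall_mem_cons, List.not_mem_nil, false_imp_iff, implies_true, and_true]
  exact saturated_of_characters (q := 719) (L := [(527, 194), (344, 674)])
    (M := [(527, 192), (344, 382)]) (by norm_num) (by decide +kernel)
    (by decide +kernel) (by decide +kernel)

end QuarticOrder

namespace QuarticOrder

/-- The unit of `ℤ[θ]`, `θ⁴ - 28θ² - 20θ - 4 = 0`, attached to a solution of a Thue equation
which is not in normalized form. -/
def quadraticUnit {x z : ℤ}
    (h : 41 * x ^ 4 + 8 * x ^ 3 * z + 64 * x ^ 2 * z ^ 2 - 28 * x * z ^ 3 - 4 * z ^ 4 = 1) :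
    (QuarticOrder (-4) (-20) (-28) 0)ˣ :=
  unitOfMul ⟨-x, -3 * x - z, -x, 0⟩
    ⟨411 * x ^ 3 + 224 * x ^ 2 * z - 156 * x * z ^ 2 - 20 * z ^ 3,
      1199 * x ^ 3 + 89 * x ^ 2 * z - 252 * x * z ^ 2 - 28 * z ^ 3,
      16 * x ^ 3 - 6 * x ^ 2 * z - x * z ^ 2,
      -43 * x ^ 3 - 3 * x ^ 2 * z + 9 * x * z ^ 2 + z ^ 3⟩ (by
    ext <;> simp only [mul_x₀, mul_x₁, mul_x₂, mul_x₃, c₄, c₅, c₆, one_x₀, one_x₁, one_x₂, one_x₃]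
    · linear_combination h
    · ring
    · ring
    · ring)

lemma quadraticUnit_val {x z : ℤ}
    (h : 41 * x ^ 4 + 8 * x ^ 3 * z + 64 * x ^ 2 * z ^ 2 - 28 * x * z ^ 3 - 4 * z ^ 4 = 1) :
    (quadraticUnit h : QuarticOrder (-4) (-20) (-28) 0) = ⟨-x, -3 * x - z, -x, 0⟩ := rfl

lemma charNat_unit_eq_one (u : (QuarticOrder (-4) (-20) (-28) 0)ˣ) :
    ∀ L ∈ [[(6, 20), (11, 0), (32, 5), (33, 15)], [(6, 0), (11, 0), (32, 5), (33, 35)],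
      [(6, 25), (11, 5), (32, 0), (33, 10)]],
      charNat 41 L (u : QuarticOrder (-4) (-20) (-28) 0) = 1 := by
  have : Fact (Nat.Prime 41) := ⟨by norm_num⟩
  have : Fact (Irreducible ((poly (-4) (-20) (-28) 0).map (Int.castRingHom ℚ))) :=
    ⟨irreducible_of_zmod (q := 13) (by norm_num) (by decide +kernel) (by decide +kernel)⟩
  let e₁ : (QuarticOrder (-4) (-20) (-28) 0)ˣ :=
    unitOfMul ⟨-29, -1, 1, 0⟩ ⟨-9, -43, -54, 11⟩ (by decide +kernel)
  let e₂ : (QuarticOrder (-4) (-20) (-28) 0)ˣ :=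
    unitOfMul ⟨-21, -54, -1, 2⟩ ⟨-1, -6, -11, -2⟩ (by decide +kernel)
  obtain ⟨m, σ, A, B, -, hm, hσ, hu⟩ := exists_coprime_pow_eq_of_irreducible (d := 8)
    (t := 0) (T := 1000) (e₁ := e₁) (e₂ := e₂) (by norm_num) (by norm_num) (by norm_num)
    (independent_of_powMod (p := 41) (E₁ := ⟨28, 6, 31, 2⟩) (E₂ := ⟨16, 28, 34, 0⟩)
      (by norm_num) (by norm_num) (by decide +kernel) (by decide +kernel) (by decide +kernel))
    (forall_prime_dvd [2] (by norm_num) (by norm_num) (by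
      simp only [List.forall_mem_cons, List.not_mem_nil, false_imp_iff, implies_true, and_true]
      exact saturated_of_powersAvoid (M := 4)
        (T := [⟨3, 2, 7, 2⟩, ⟨5, 6, 1, 6⟩, ⟨3, 7, 1, 0⟩, ⟨5, 1, 7, 0⟩, ⟨5, 7, 2, 1⟩, ⟨3, 1, 6, 7⟩])
        (by norm_num) (by norm_num) (by norm_num) (by decide +kernel) (by decide +kernel))) u
  have hchar : ∀ L ∈ [[(6, 20), (11, 0), (32, 5), (33, 15)], [(6, 0), (11, 0), (32, 5), (33, 35)],
      [(6, 25), (11, 5), (32, 0), (33, 10)]], IsCharacter (-4) (-20) (-28) 0 41 8 L ∧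
      charNat 41 L (-1 : QuarticOrder (-4) (-20) (-28) 0) = 1 ∧
      charNat 41 L (e₁ : QuarticOrder (-4) (-20) (-28) 0) = 1 ∧
      charNat 41 L (e₂ : QuarticOrder (-4) (-20) (-28) 0) = 1 := by decide +kernel
  exact fun L hL => charHom_eq_one (hchar L hL).1 hm hσ hu (hchar L hL).2

lemma charNat_congr {f₀ f₁ f₂ f₃ : ℤ} {p : ℕ} (L : List (ℕ × ℕ)) {x y : QuarticOrder f₀ f₁ f₂ f₃}
    (h₀ : x.x₀ ≡ y.x₀ [ZMOD p]) (h₁ : x.x₁ ≡ y.x₁ [ZMOD p]) (h₂ : x.x₂ ≡ y.x₂ [ZMOD p])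
    (h₃ : x.x₃ ≡ y.x₃ [ZMOD p]) : charNat p L x = charNat p L y := by
  unfold charNat
  congr 2
  apply List.map_congr_left
  intro z _
  congr 2
  exact ((h₀.add (h₁.mul_right _)).add (h₂.mul_right _)).add (h₃.mul_right _)

/-- A quartic Thue equation with a side condition that fails modulo `41`. -/
lemma sq_ne_of_quartic_eq_one {x z M : ℤ}
    (h : 41 * x ^ 4 + 8 * x ^ 3 * z + 64 * x ^ 2 * z ^ 2 - 28 * x * z ^ 3 - 4 * z ^ 4 = 1) :
    M ^ 2 ≠ 8 * (-155 * x ^ 4 + 110 * x ^ 3 * z + 20 * x * z ^ 3 + 25 * z ^ 4) + 25 := by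
  intro hM
  have h1 := charNat_unit_eq_one (quadraticUnit h)
  rw [quadraticUnit_val] at h1
  have key : ∀ x ∈ List.range 41, ∀ z ∈ List.range 41,
      (41 * x ^ 4 + 8 * x ^ 3 * z + 64 * x ^ 2 * z ^ 2 - 28 * x * z ^ 3 - 4 * z ^ 4 : ℤ) % 41 = 1 →
      (8 * (-155 * x ^ 4 + 110 * x ^ 3 * z + 20 * x * z ^ 3 + 25 * z ^ 4) + 25 : ℤ) % 41 ∈
        (List.range 41).map (fun y => ((y ^ 2 % 41 : ℕ) : ℤ)) →
      ¬ ∀ L ∈ [[(6, 20), (11, 0), (32, 5), (33, 15)], [(6, 0), (11, 0), (32, 5), (33, 35)],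
      [(6, 25), (11, 5), (32, 0), (33, 10)]],
      charNat 41 L (⟨-x, -3 * x - z, -x, 0⟩ : QuarticOrder (-4) (-20) (-28) 0) = 1 := by
    decide +kernel
  obtain ⟨x', hx', hx⟩ : ∃ m < 41, (41 : ℤ) ∣ x - (m : ℕ) := ⟨(x % 41).toNat, by omega, by omega⟩
  obtain ⟨z', hz', hz⟩ : ∃ m < 41, (41 : ℤ) ∣ z - (m : ℕ) := ⟨(z % 41).toNat, by omega, by omega⟩
  obtain ⟨M', hM', hMM⟩ : ∃ m < 41, (41 : ℤ) ∣ M - (m : ℕ) := ⟨(M % 41).toNat, by omega, by omega⟩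
  have hx := (Int.modEq_iff_dvd.2 hx)
  have hz := (Int.modEq_iff_dvd.2 hz)
  have hMM := (Int.modEq_iff_dvd.2 hMM)
  refine key x' (List.mem_range.2 hx') z' (List.mem_range.2 hz') ?_ ?_ ?_
  · have : (41 * x' ^ 4 + 8 * x' ^ 3 * z' + 64 * x' ^ 2 * z' ^ 2 - 28 * x' * z' ^ 3 - 4 * z' ^ 4 : ℤ)
      ≡ 41 * x ^ 4 + 8 * x ^ 3 * z + 64 * x ^ 2 * z ^ 2 - 28 * x * z ^ 3 - 4 * z ^ 4 [ZMOD 41] := by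
      gcongr
    rw [this, h]; rfl
  · refine List.mem_map.2 ⟨M', List.mem_range.2 hM', ?_⟩
    have : (8 * (-155 * x' ^ 4 + 110 * x' ^ 3 * z' + 20 * x' * z' ^ 3 + 25 * z' ^ 4) + 25 : ℤ)
      ≡ 8 * (-155 * x ^ 4 + 110 * x ^ 3 * z + 20 * x * z ^ 3 + 25 * z ^ 4) + 25 [ZMOD 41] := by
      gcongr
    rw [this, ← hM]
    have h2 : (M' : ℤ) ^ 2 ≡ M ^ 2 [ZMOD 41] := by gcongr
    rw [← h2]
    norm_cast
  · intro L hL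
    rw [← h1 L hL]
    refine charNat_congr L ?_ ?_ ?_ ?_
    all_goals dsimp only; push_cast; gcongr

end QuarticOrder

namespace BinaryQuartic

/-- Reduction bounds for a real quartic with a purely imaginary root. -/
lemma bounds_of_imaginary_root {a B C D E y : ℝ} (hy : 3 / 4 ≤ y ^ 2)
    (h₁ : a * y ^ 4 - C * y ^ 2 + E = 0) (h₂ : D = B * y ^ 2)
    (hI : 12 * a * E - 3 * B * D + C ^ 2 = 2800)
    (hJ : 72 * a * C * E + 9 * B * C * D - 27 * a * D ^ 2 - 27 * E * B ^ 2 - 2 * C ^ 3 = -2270000) :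
    -5 < a ∧ a < 107 ∧
      (0 < a → 9 * a ^ 2 - 308 * a - 4172 ≤ 8 * a * C - 3 * B ^ 2 ∧
        8 * a * C - 3 * B ^ 2 ≤ 616 * a) ∧
      (a < 0 → -4172 ≤ 8 * a * C - 3 * B ^ 2 ∧ 8 * a * C - 3 * B ^ 2 < 0) := by
  have hE : E = C * y ^ 2 - a * y ^ 4 := by linear_combination h₁
  subst hE h₂
  have hC : C ^ 3 - 2100 * C = 283750 := by linear_combination -hJ / 8 + 3 / 4 * C * hI
  have hC1 : 76 < C := by
    by_contra! h
    nlinarith [sq_nonneg (C + 27), sq_nonneg (C + 38), sq_nonneg C]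
  have hC2 : C < 76.5 := by
    by_contra! h
    nlinarith [mul_self_nonneg (C - 76.5)]
  set α := a * y ^ 2 with hα
  have hB : 3 * B ^ 2 * y ^ 2 = 12 * α * (C - α) + C ^ 2 - 2800 := by
    rw [hα]; linear_combination -hI
  have hBy : 0 ≤ 12 * α * (C - α) + C ^ 2 - 2800 := by rw [← hB]; positivity
  have hK : C ^ 2 < 5853 := by nlinarith
  have hK' : 5776 < C ^ 2 := by nlinarith
  have hα1 : α < 80 := by
    by_contra! h
    nlinarith
  have hα2 : -3.5 < α := by
    by_contra! h
    nlinarith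
  have hH : (8 * a * C - 3 * B ^ 2) * y ^ 2 = 12 * α ^ 2 - 4 * α * C - (C ^ 2 - 2800) := by
    rw [sub_mul, hB, hα]; ring
  have hy0 : 0 < y ^ 2 := by linarith
  refine ⟨by nlinarith, by nlinarith, fun h => ⟨?_, ?_⟩, fun h => ⟨?_, ?_⟩⟩
  · have hα0 : 0 < α := by positivity
    refine le_of_mul_le_mul_right ?_ hy0
    rw [hH]
    have h3 : 0 ≤ 3 * α * a * (4 * y ^ 2 - 3) := by
      have : 0 ≤ 4 * y ^ 2 - 3 := by linarith
      positivity
    have h4 : (9 * a ^ 2 - 308 * a - 4172) * y ^ 2 = 9 * a * α - 308 * α - 4172 * y ^ 2 := by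
      rw [hα]; ring
    have h5 : 3 * α * a * (4 * y ^ 2 - 3) = 12 * α ^ 2 - 9 * a * α := by
      rw [hα]; ring
    nlinarith [mul_pos hα0 (show 0 < 77 - C by linarith)]
  · nlinarith [sq_nonneg B]
  · have hα0 : α < 0 := mul_neg_of_neg_of_pos h hy0
    refine le_of_mul_le_mul_right ?_ hy0
    rw [hH]
    nlinarith [mul_pos (neg_pos.2 hα0) (show 0 < C by linarith), sq_nonneg α]
  · nlinarith [sq_nonneg B]

lemma bounds_of_root {a b c d e : ℤ} {w : ℂ} (hw : 3 / 4 ≤ w.im ^ 2)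
    (h : a * w ^ 4 + b * w ^ 3 + c * w ^ 2 + d * w + e = 0)
    (hI : 12 * a * e - 3 * b * d + c ^ 2 = 2800)
    (hJ : 72 * a * c * e + 9 * b * c * d - 27 * a * d ^ 2 - 27 * e * b ^ 2 - 2 * c ^ 3 = -2270000) :
    -5 < a ∧ a < 107 ∧
      (0 < a → 9 * a ^ 2 - 308 * a - 4172 ≤ 8 * a * c - 3 * b ^ 2 ∧
        8 * a * c - 3 * b ^ 2 ≤ 616 * a) ∧
      (a < 0 → -4172 ≤ 8 * a * c - 3 * b ^ 2 ∧ 8 * a * c - 3 * b ^ 2 < 0) := by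
  obtain ⟨hre, him⟩ := Complex.ext_iff.1 h
  simp [pow_succ] at hre him
  set x := w.re
  set y := w.im
  have hy : y ≠ 0 := by rintro h; norm_num [h] at hw
  have hI' : (12 * a * e - 3 * b * d + c ^ 2 : ℝ) = 2800 := by exact_mod_cast hI
  have hJ' : (72 * a * c * e + 9 * b * c * d - 27 * a * d ^ 2 - 27 * e * b ^ 2 - 2 * c ^ 3 : ℝ) =
    -2270000 := by exact_mod_cast hJ
  have hd : (d + 2 * c * x + 3 * b * x ^ 2 + 4 * a * x ^ 3 : ℝ) = (b + 4 * a * x) * y ^ 2 :=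
    mul_right_cancel₀ hy (by linear_combination him)
  have := bounds_of_imaginary_root (a := a) (B := b + 4 * a * x) (C := c + 3 * b * x + 6 * a * x ^ 2)
    (E := e + d * x + c * x ^ 2 + b * x ^ 3 + a * x ^ 4) hw
    (by linear_combination hre) hd (by linear_combination hI') (by linear_combination hJ')
  rw [show (8 * a * (c + 3 * b * x + 6 * a * x ^ 2) - 3 * (b + 4 * a * x) ^ 2 : ℝ) =
    8 * a * c - 3 * b ^ 2 by ring] at this
  exact_mod_cast this

end BinaryQuartic

/-- Integral binary quartic forms `a x⁴ + b x³z + c x²z² + d xz³ + e z⁴`. -/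
@[ext]
structure BinaryQuartic where
  (a b c d e : ℤ)

namespace BinaryQuartic

variable (F : BinaryQuartic)

/-- The value of the form at `(x, z)`. -/
def eval (x z : ℤ) : ℤ :=
  F.a * x ^ 4 + F.b * x ^ 3 * z + F.c * x ^ 2 * z ^ 2 + F.d * x * z ^ 3 + F.e * z ^ 4

/-- The invariant `I` of degree two. -/
def invI : ℤ := 12 * F.a * F.e - 3 * F.b * F.d + F.c ^ 2

/-- The invariant `J` of degree three. -/
def invJ : ℤ :=
  72 * F.a * F.c * F.e + 9 * F.b * F.c * F.d - 27 * F.a * F.d ^ 2 - 27 * F.e * F.b ^ 2 - 2 * F.c ^ 3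

/-- The Hessian covariant. -/
def hessian : BinaryQuartic :=
  ⟨8 * F.a * F.c - 3 * F.b ^ 2, 4 * (6 * F.a * F.d - F.b * F.c),
    2 * (24 * F.a * F.e + 3 * F.b * F.d - 2 * F.c ^ 2), 4 * (6 * F.b * F.e - F.c * F.d),
    8 * F.c * F.e - 3 * F.d ^ 2⟩

/-- The form `F (p x + q z, r x + t z)`. -/
def subst (p q r t : ℤ) : BinaryQuartic where
  a := F.eval p r
  b := 4 * F.a * p ^ 3 * q + F.b * (p ^ 3 * t + 3 * p ^ 2 * q * r) +
    2 * F.c * (p ^ 2 * r * t + p * q * r ^ 2) + F.d * (q * r ^ 3 + 3 * p * r ^ 2 * t) +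
    4 * F.e * r ^ 3 * t
  c := 6 * F.a * p ^ 2 * q ^ 2 + 3 * F.b * (p ^ 2 * q * t + p * q ^ 2 * r) +
    F.c * (p ^ 2 * t ^ 2 + 4 * p * q * r * t + q ^ 2 * r ^ 2) +
    3 * F.d * (p * r * t ^ 2 + q * r ^ 2 * t) + 6 * F.e * r ^ 2 * t ^ 2
  d := 4 * F.a * p * q ^ 3 + F.b * (q ^ 3 * r + 3 * p * q ^ 2 * t) +
    2 * F.c * (q ^ 2 * r * t + p * q * t ^ 2) + F.d * (p * t ^ 3 + 3 * q * r * t ^ 2) +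
    4 * F.e * r * t ^ 3
  e := F.eval q t

lemma eval_subst (p q r t x z : ℤ) :
    (F.subst p q r t).eval x z = F.eval (p * x + q * z) (r * x + t * z) := by
  simp only [eval, subst]
  ring

lemma invI_subst (p q r t : ℤ) :
    (F.subst p q r t).invI = (p * t - q * r) ^ 4 * F.invI := by
  simp only [invI, eval, subst]
  ring

lemma invJ_subst (p q r t : ℤ) :
    (F.subst p q r t).invJ = (p * t - q * r) ^ 6 * F.invJ := by
  simp only [invJ, eval, subst]
  ring

lemma hessian_subst (p q r t x z : ℤ) :
    (F.subst p q r t).hessian.eval x z =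
      (p * t - q * r) ^ 2 * F.hessian.eval (p * x + q * z) (r * x + t * z) := by
  simp only [hessian, eval, subst]
  ring

end BinaryQuartic

namespace BinaryQuartic

/-- Integer square root of `n` found by `k` halving steps, valid for `n < 4 ^ k`. -/
def sqrtAux : ℕ → ℕ → ℕ
  | 0, _ => 0
  | k + 1, n =>
    match sqrtAux k (n / 4) with
    | 0 => if 1 ≤ n then 1 else 0
    | r + 1 => if (2 * r + 3) * (2 * r + 3) ≤ n then 2 * r + 3 else 2 * r + 2

/-- The reduced forms which are not excluded by local conditions. -/
def survivors : List BinaryQuartic :=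
  [⟨1, 0, 10, 300, 225⟩, ⟨16, -12, 4, 72, 1⟩, ⟨36, 60, 100, 100, 25⟩, ⟨1, 0, -50, 300, 25⟩,
    ⟨36, 12, 64, 48, 1⟩, ⟨41, -8, 64, 28, -4⟩, ⟨1, 0, -410, 4500, -13775⟩, ⟨76, 36, 76, 36, 1⟩,
    ⟨81, -76, 76, 4, -4⟩, ⟨-4, -4, 76, 76, 81⟩, ⟨1, 0, 40, 300, 100⟩, ⟨1, 0, -140, 900, -1400⟩]

instance : DecidableEq BinaryQuartic := fun F G =>
  decidable_of_iff (F.a = G.a ∧ F.b = G.b ∧ F.c = G.c ∧ F.d = G.d ∧ F.e = G.e)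
    BinaryQuartic.ext_iff.symm

/-- Test of a single form. -/
def checkForm (F : BinaryQuartic) (H R : ℤ) : Bool :=
  decide (8 * F.a * F.c - 3 * F.b ^ 2 ≠ H) ||
  decide (F.b ^ 3 + 8 * F.a ^ 2 * F.d - 4 * F.a * F.b * F.c ≠ R) ||
  decide (F.invI ≠ 2800) ||
  ((List.range 20).all fun l => (List.range 20).all fun m => decide
    (¬ ((20 : ℤ) ∣ F.a - l ^ 4 ∧ (20 : ℤ) ∣ F.b - 4 * l ^ 3 * m ∧
      (20 : ℤ) ∣ F.c - 6 * l ^ 2 * m ^ 2 ∧ (20 : ℤ) ∣ F.d - 4 * l * m ^ 3 ∧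
      (20 : ℤ) ∣ F.e - m ^ 4))) ||
  decide ((5 : ℤ) ∣ F.a ∧ (5 : ℤ) ∣ F.b ∧ (5 : ℤ) ∣ F.c ∧ (5 : ℤ) ∣ F.d ∧ (5 : ℤ) ∣ F.e) ||
  decide (F ∈ survivors)

/-- Test of all forms with given seminvariants `a`, `H`, `R`. -/
def checkSeminvariants (a H R : ℤ) : Bool :=
  (List.range (2 * (a.natAbs / 2) + 1)).all fun j =>
    let b : ℤ := 4 * (j - a.natAbs / 2)
    let c := (H + 3 * b ^ 2) / (8 * a)
    let d := (R - b ^ 3 + 4 * a * b * c) / (8 * a ^ 2)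
    checkForm ⟨a, b, c, d, (2800 - c ^ 2 + 3 * b * d) / (12 * a)⟩ H R

/-- Test whether `N = 27 R ^ 2` is impossible, or else leads only to known forms. -/
def checkRoot (a H : ℤ) (n k : ℕ) : Bool :=
  decide (k * k ≤ n) && decide (n < (k + 1) * (k + 1)) &&
    (decide (k * k ≠ n) || checkSeminvariants a H k)

/-- Test of all reduced forms with leading coefficient `a` and leading coefficient `80 h` of the
Hessian. -/
def checkLeading (a h : ℤ) : Bool :=
  let H := 80 * h
  let N := 134400 * H * a ^ 2 + 145280000 * a ^ 3 - H ^ 3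
  decide ((27 : ℤ) ∣ N → N < 0) ||
    checkRoot a H (N / 27).toNat (sqrtAux 32 (N / 27).toNat)

/-- The range of seminvariants allowed by reduction theory. -/
def checkBounds (a h : ℤ) : Bool :=
  decide (0 < a ∧ (9 * a ^ 2 - 308 * a - 4172 > 80 * h ∨ 80 * h > 616 * a)) ||
  decide (a ≤ 0 ∧ (-4172 > 80 * h ∨ 0 ≤ 80 * h)) || checkLeading a h

theorem checkBounds_eq_true : ∀ a ∈ [-4, 1, 5, 16, 20, 21, 25, 36, 40, 41, 45, 56, 60, 61, 65, 76,
    80, 81, 85, 96, 100, 101, 105], ∀ j ∈ List.range 920, checkBounds a (j - 90) = true := by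
  decide +kernel

end BinaryQuartic

namespace BinaryQuartic

/-- The form is congruent modulo `20` to a fourth power of a linear form. -/
def IsPowMod (F : BinaryQuartic) : Prop :=
  ∃ l m : ZMod 20, (F.a : ZMod 20) = l ^ 4 ∧ (F.b : ZMod 20) = 4 * l ^ 3 * m ∧
    (F.c : ZMod 20) = 6 * l ^ 2 * m ^ 2 ∧ (F.d : ZMod 20) = 4 * l * m ^ 3 ∧
    (F.e : ZMod 20) = m ^ 4

lemma IsPowMod.subst {F : BinaryQuartic} (h : F.IsPowMod) (p q r t : ℤ) :
    (F.subst p q r t).IsPowMod := by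
  obtain ⟨l, m, h₁, h₂, h₃, h₄, h₅⟩ := h
  refine ⟨l * p + m * r, l * q + m * t, ?_⟩
  simp only [BinaryQuartic.subst, eval]
  push_cast
  rw [h₁, h₂, h₃, h₄, h₅]
  refine ⟨?_, ?_, ?_, ?_, ?_⟩ <;> ring

lemma IsPowMod.exists_nat {F : BinaryQuartic} (h : F.IsPowMod) :
    ∃ l ∈ List.range 20, ∃ m ∈ List.range 20, (20 : ℤ) ∣ F.a - l ^ 4 ∧
      (20 : ℤ) ∣ F.b - 4 * l ^ 3 * m ∧ (20 : ℤ) ∣ F.c - 6 * l ^ 2 * m ^ 2 ∧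
      (20 : ℤ) ∣ F.d - 4 * l * m ^ 3 ∧ (20 : ℤ) ∣ F.e - m ^ 4 := by
  obtain ⟨l, m, h₁, h₂, h₃, h₄, h₅⟩ := h
  have key (x y : ℤ) (h : (x : ZMod 20) = y) : (20 : ℤ) ∣ x - y :=
    (ZMod.intCast_eq_intCast_iff_dvd_sub y x 20).1 h.symm
  refine ⟨l.val, List.mem_range.2 l.val_lt, m.val, List.mem_range.2 m.val_lt, key _ _ ?_,
    key _ _ ?_, key _ _ ?_, key _ _ ?_, key _ _ ?_⟩ <;> push_cast <;>
    simpa only [ZMod.natCast_zmod_val]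

/-- The seminvariant of degree three. -/
def semR (F : BinaryQuartic) : ℤ := F.b ^ 3 + 8 * F.a ^ 2 * F.d - 4 * F.a * F.b * F.c

lemma syzygy (F : BinaryQuartic) :
    27 * F.semR ^ 2 =
      48 * F.invI * F.hessian.a * F.a ^ 2 - 64 * F.invJ * F.a ^ 3 - F.hessian.a ^ 3 := by
  simp only [semR, invI, invJ, hessian]
  ring

lemma mem_survivors_of_checkForm {F : BinaryQuartic} (h : checkForm F F.hessian.a F.semR = true)
    (hI : F.invI = 2800) (hF : F.IsPowMod) :
    (5 ∣ F.a ∧ 5 ∣ F.b ∧ 5 ∣ F.c ∧ 5 ∣ F.d ∧ 5 ∣ F.e) ∨ F ∈ survivors := by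
  simp only [checkForm, Bool.or_eq_true, decide_eq_true_eq, List.all_eq_true] at h
  rcases h with ((((h | h) | h) | h) | h) | h
  · exact absurd rfl h
  · exact absurd rfl h
  · exact absurd hI h
  · obtain ⟨l, hl, m, hm, H⟩ := hF.exists_nat
    exact absurd H (h l hl m hm)
  · exact .inl h
  · exact .inr h

lemma IsPowMod.dvd {F : BinaryQuartic} (h : F.IsPowMod) :
    4 ∣ F.b ∧ 80 ∣ F.hessian.a ∧ (F.a % 20 = 0 ∨ F.a % 20 = 1 ∨ F.a % 20 = 5 ∨ F.a % 20 = 16) := by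
  obtain ⟨l, hl, m, -, ⟨a, ha⟩, ⟨b, hb⟩, ⟨c, hc⟩, -, -⟩ := h.exists_nat
  refine ⟨⟨l ^ 3 * m + 5 * b, by linear_combination hb⟩,
    ⟨2 * l ^ 4 * c + 12 * a * l ^ 2 * m ^ 2 + 40 * a * c - 15 * b ^ 2 - 6 * b * l ^ 3 * m, ?_⟩, ?_⟩
  · rw [sub_eq_iff_eq_add] at ha hb hc
    simp only [hessian, ha, hb, hc]
    ring
  · rw [List.mem_range] at hl
    interval_cases l <;> norm_num at ha <;> omega

/-- A form satisfying the inequalities of reduction theory. -/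
structure IsReduced (F : BinaryQuartic) : Prop where
  ne_zero : F.a ≠ 0
  neg_five_lt : -5 < F.a
  lt : F.a < 107
  of_pos : 0 < F.a → 9 * F.a ^ 2 - 308 * F.a - 4172 ≤ F.hessian.a ∧ F.hessian.a ≤ 616 * F.a
  of_neg : F.a < 0 → -4172 ≤ F.hessian.a ∧ F.hessian.a < 0
  abs_le : |F.b| ≤ 2 * |F.a|
  semR_nonneg : 0 ≤ F.semR

lemma mem_survivors {F : BinaryQuartic} (hF : F.IsReduced) (hI : F.invI = 2800)
    (hJ : F.invJ = -2270000) (hP : F.IsPowMod) :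
    (5 ∣ F.a ∧ 5 ∣ F.b ∧ 5 ∣ F.c ∧ 5 ∣ F.d ∧ 5 ∣ F.e) ∨ F ∈ survivors := by
  obtain ⟨⟨b, hb⟩, ⟨h, hh⟩, ha⟩ := hP.dvd
  obtain ⟨h0, h1, h2, h3, h4, h5, h6⟩ := hF
  have hmem : F.a ∈ [-4, 1, 5, 16, 20, 21, 25, 36, 40, 41, 45, 56, 60, 61, 65, 76,
      80, 81, 85, 96, 100, 101, 105] := by
    simp only [List.mem_cons, List.not_mem_nil, or_false]
    omega
  have hh1 : -6900 ≤ 80 * h ∧ 80 * h ≤ 616 * 106 := by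
    rcases lt_or_gt_of_ne h0 with h' | h'
    · have := h4 h'
      omega
    · have := h3 h'
      refine ⟨?_, by omega⟩
      rw [← hh]
      nlinarith [sq_nonneg (F.a - 17)]
  have hc := checkBounds_eq_true F.a hmem (h + 90).toNat (List.mem_range.2 (by omega))
  rw [Int.toNat_of_nonneg (by omega), add_sub_cancel_right] at hc
  simp only [checkBounds, Bool.or_eq_true, decide_eq_true_eq] at hc
  rcases hc with (hc | hc) | hc
  · have := h3 hc.1
    omega
  · have := h4 (lt_of_le_of_ne hc.1 h0)
    omega
  have hN := F.syzygy
  rw [hI, hJ, hh] at hN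
  have hN' : 134400 * (80 * h) * F.a ^ 2 + 145280000 * F.a ^ 3 - (80 * h) ^ 3 =
    27 * F.semR ^ 2 := by linear_combination -hN
  simp only [checkLeading, hN', Bool.or_eq_true, decide_eq_true_eq] at hc
  rcases hc with hc | hc
  · have := hc (dvd_mul_right _ _)
    nlinarith [sq_nonneg F.semR]
  obtain ⟨R, hR⟩ := Int.eq_ofNat_of_zero_le h6
  rw [Int.mul_ediv_cancel_left _ (by norm_num), hR,
    show ((R : ℤ) ^ 2).toNat = R * R by rw [← sq]; exact_mod_cast Int.toNat_natCast (R ^ 2)] at hc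
  generalize sqrtAux 32 (R * R) = k at hc
  simp only [checkRoot, Bool.or_eq_true, Bool.and_eq_true, decide_eq_true_eq] at hc
  obtain ⟨⟨hk1, hk2⟩, hk⟩ := hc
  obtain rfl : k = R := le_antisymm (Nat.mul_self_le_mul_self_iff.1 hk1)
    (Nat.lt_succ_iff.1 (Nat.mul_self_lt_mul_self_iff.1 hk2))
  replace hk := hk.resolve_left (by simp)
  simp only [checkSeminvariants, List.all_eq_true, List.mem_range] at hk
  have hb2 : |b| ≤ |F.a| / 2 := by
    rw [hb, abs_mul, abs_of_pos (by norm_num : (0 : ℤ) < 4)] at h5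
    omega
  rw [Int.abs_eq_natAbs F.a] at hb2
  have hb3 := abs_le.1 hb2
  have hk := hk (b + F.a.natAbs / 2).toNat (by omega)
  rw [Int.toNat_of_nonneg (by omega), add_sub_cancel_right, ← hb] at hk
  have hc : (80 * h + 3 * F.b ^ 2) / (8 * F.a) = F.c := by
    refine Int.ediv_eq_of_eq_mul_right (by omega) ?_
    rw [← hh, hessian]
    ring
  have hd : (↑k - F.b ^ 3 + 4 * F.a * F.b * F.c) / (8 * F.a ^ 2) = F.d := by
    refine Int.ediv_eq_of_eq_mul_right (by positivity) ?_
    rw [show (k : ℤ) = F.semR from hR.symm, semR]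
    ring
  have he : (2800 - F.c ^ 2 + 3 * F.b * F.d) / (12 * F.a) = F.e := by
    refine Int.ediv_eq_of_eq_mul_right (by omega) ?_
    rw [← hI, invI]
    ring
  rw [hc, hd, he, ← hh, show (k : ℤ) = F.semR from hR.symm] at hk
  exact mem_survivors_of_checkForm hk hI hP

end BinaryQuartic

namespace BinaryQuartic

/-- The form represents `1` at a point where the Hessian takes the value prescribed by `s`. -/
def RepresentsOne (s : ℤ) (F : BinaryQuartic) : Prop :=
  ∃ u v, F.eval u v = 1 ∧ F.hessian.eval u v = -(400 + 240 * s)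

/-- The properties, invariant under integral equivalence, of the quartic attached to a point of
`5 Z² = 4 s³ + 20 s² + 24 s + 45`. -/
structure IsAdmissible (s : ℤ) (F : BinaryQuartic) : Prop where
  invI : F.invI = 2800
  invJ : F.invJ = -2270000
  isPowMod : F.IsPowMod
  representsOne : RepresentsOne s F
  eval_ne_zero : ∀ u v, IsCoprime u v → F.eval u v ≠ 0

/-- The dehomogenized form has a root with imaginary part at least `√3 / 2` in absolute value. -/
def HasHighRoot (F : BinaryQuartic) : Prop :=
  ∃ w : ℂ, 3 / 4 ≤ w.im ^ 2 ∧ F.a * w ^ 4 + F.b * w ^ 3 + F.c * w ^ 2 + F.d * w + F.e = 0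

variable {s : ℤ} {F : BinaryQuartic}

lemma IsAdmissible.subst (h : IsAdmissible s F) {p q r t : ℤ}
    (hD : p * t - q * r = 1 ∨ p * t - q * r = -1) : IsAdmissible s (F.subst p q r t) := by
  have hD2 : (p * t - q * r) ^ 2 = 1 := by rcases hD with h | h <;> rw [h] <;> norm_num
  set D := p * t - q * r with hDdef
  have hinv (u v : ℤ) : p * (D * (t * u - q * v)) + q * (D * (p * v - r * u)) = u ∧
      r * (D * (t * u - q * v)) + t * (D * (p * v - r * u)) = v := by
    constructor
    · linear_combination u * hD2 - D * u * hDdef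
    · linear_combination v * hD2 - D * v * hDdef
  refine ⟨?_, ?_, h.isPowMod.subst .., ?_, fun u v huv => ?_⟩
  · rw [invI_subst, h.invI, ← hDdef, show D ^ 4 = (D ^ 2) ^ 2 by ring, hD2]
    norm_num
  · rw [invJ_subst, h.invJ, ← hDdef, show D ^ 6 = (D ^ 2) ^ 3 by ring, hD2]
    norm_num
  · obtain ⟨u, v, h1, h2⟩ := h.representsOne
    refine ⟨D * (t * u - q * v), D * (p * v - r * u), ?_, ?_⟩
    · rw [eval_subst, (hinv u v).1, (hinv u v).2, h1]
    · rw [hessian_subst, (hinv u v).1, (hinv u v).2, h2, ← hDdef, hD2, one_mul]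
  · rw [eval_subst]
    obtain ⟨x, y, hxy⟩ := huv
    refine h.eval_ne_zero _ _ ⟨D * (t * x - r * y), D * (p * y - q * x), ?_⟩
    linear_combination hxy * D ^ 2 + hD2 - D * (x * u + y * v) * hDdef

lemma IsAdmissible.a_ne_zero (h : IsAdmissible s F) : F.a ≠ 0 := by
  have := h.eval_ne_zero 1 0 isCoprime_one_left
  simpa [eval] using this

lemma HasHighRoot.shear (h : F.HasHighRoot) (k : ℤ) : (F.subst 1 k 0 1).HasHighRoot := by
  obtain ⟨w, hw, h⟩ := h
  refine ⟨w - k, by simpa using hw, ?_⟩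
  simp only [BinaryQuartic.subst, eval]
  push_cast
  linear_combination h

lemma HasHighRoot.reflect (h : F.HasHighRoot) : (F.subst 1 0 0 (-1)).HasHighRoot := by
  obtain ⟨w, hw, h⟩ := h
  refine ⟨-w, by simpa using hw, ?_⟩
  simp only [BinaryQuartic.subst, eval]
  push_cast
  linear_combination h

lemma exists_shear_abs_le (F : BinaryQuartic) (ha : F.a ≠ 0) :
    ∃ k, |(F.subst 1 k 0 1).b| ≤ 2 * |(F.subst 1 k 0 1).a| := by
  refine ⟨-((F.b + 2 * |F.a|) / (4 * F.a)), ?_⟩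
  have h1 := Int.emod_add_mul_ediv (F.b + 2 * |F.a|) (4 * F.a)
  have h2 := Int.emod_nonneg (F.b + 2 * |F.a|) (show 4 * F.a ≠ 0 by omega)
  have h3 := Int.emod_lt_abs (F.b + 2 * |F.a|) (show 4 * F.a ≠ 0 by omega)
  rw [abs_mul, abs_of_pos (by norm_num : (0 : ℤ) < 4)] at h3
  set Q := (F.b + 2 * |F.a|) / (4 * F.a)
  have hb : (F.subst 1 (-Q) 0 1).b = F.b - 4 * F.a * Q := by
    simp only [BinaryQuartic.subst]
    ring
  have ha' : (F.subst 1 (-Q) 0 1).a = F.a := by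
    simp only [BinaryQuartic.subst, eval]
    ring
  rw [hb, ha', abs_le]
  constructor <;> linarith

/-- A reduced representative of the equivalence class. -/
lemma IsAdmissible.exists_isReduced (h : IsAdmissible s F) (hF : F.HasHighRoot) :
    ∃ G, IsAdmissible s G ∧ G.IsReduced := by
  obtain ⟨k, hk⟩ := F.exists_shear_abs_le h.a_ne_zero
  have h' := h.subst (p := 1) (q := k) (r := 0) (t := 1) (by norm_num)
  have hF' := hF.shear k
  obtain ⟨G, hG, hGr, hGb, hGR⟩ : ∃ G, IsAdmissible s G ∧ G.HasHighRoot ∧ |G.b| ≤ 2 * |G.a| ∧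
      0 ≤ G.semR := by
    generalize F.subst 1 k 0 1 = G at h' hF' hk
    rcases le_total 0 G.semR with hR | hR
    · exact ⟨G, h', hF', hk, hR⟩
    · refine ⟨G.subst 1 0 0 (-1), h'.subst (by norm_num), hF'.reflect, ?_, ?_⟩
      · simpa [BinaryQuartic.subst, eval] using hk
      · have : (G.subst 1 0 0 (-1)).semR = -G.semR := by
          simp only [BinaryQuartic.subst, eval, semR]
          ring
        omega
  obtain ⟨w, hw, hw0⟩ := hGr
  obtain ⟨h1, h2, h3, h4⟩ := bounds_of_root hw hw0 hG.invI hG.invJ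
  exact ⟨G, hG, hG.a_ne_zero, h1, h2, h3, h4, hGb, hGR⟩

end BinaryQuartic

namespace BinaryQuartic

variable {s : ℤ}

lemma RepresentsOne.of_subst {F G : BinaryQuartic} (h : RepresentsOne s G) (p q r t : ℤ)
    (hG : G = F.subst p q r t) (hD : (p * t - q * r) ^ 2 = 1) : RepresentsOne s F := by
  subst hG
  obtain ⟨u, v, h₁, h₂⟩ := h
  rw [eval_subst] at h₁
  rw [hessian_subst, hD, one_mul] at h₂
  exact ⟨_, _, h₁, h₂⟩

lemma RepresentsOne.eq_of_root {F : BinaryQuartic} (h : RepresentsOne s F) {e : ℤ}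
    (ha : F.a = 1) (hH : F.hessian.a = -(400 + 240 * e)) (hF : ∀ x z, F.eval x z = 1 → z = 0) :
    s = e := by
  obtain ⟨u, v, h₁, h₂⟩ := h
  obtain rfl := hF u v h₁
  simp [eval, ha] at h₁
  simp [eval, hH, h₁] at h₂
  omega

lemma RepresentsOne.eq_of_root' {F : BinaryQuartic} (h : RepresentsOne s F) {e : ℤ}
    (ha : F.e = 1) (hH : F.hessian.e = -(400 + 240 * e)) (hF : ∀ x z, F.eval x z = 1 → x = 0) :
    s = e := by
  obtain ⟨u, v, h₁, h₂⟩ := h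
  obtain rfl := hF u v h₁
  simp [eval, ha] at h₁
  simp [eval, hH, h₁] at h₂
  omega

lemma RepresentsOne.eq_of_1_4_16_neg276_neg64 (h : RepresentsOne s ⟨1, 4, 16, -276, -64⟩) : s = -2 := by
  refine h.eq_of_root rfl rfl fun x z h =>
    QuarticOrder.eq_zero_of_normForm_neg64_neg276_16_4 (P := x) ?_
  rw [← h, QuarticOrder.normForm, eval]
  ring

lemma RepresentsOne.eq_of_16_12_4_neg72_1 (h : RepresentsOne s ⟨16, 12, 4, -72, 1⟩) : s = 63 := by
  refine h.eq_of_root' rfl rfl fun x z h =>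
    QuarticOrder.eq_zero_of_normForm_16_12_4_neg72 (P := z) ?_
  rw [← h, QuarticOrder.normForm, eval]
  ring

lemma RepresentsOne.eq_of_25_0_neg50_60_1 (h : RepresentsOne s ⟨25, 0, -50, 60, 1⟩) : s = 45 := by
  refine h.eq_of_root' rfl rfl fun x z h =>
    QuarticOrder.eq_zero_of_normForm_25_0_neg50_60 (P := z) ?_
  rw [← h, QuarticOrder.normForm, eval]
  ring

lemma RepresentsOne.eq_of_25_300_neg50_0_1 (h : RepresentsOne s ⟨25, 300, -50, 0, 1⟩) : s = 0 := by
  refine h.eq_of_root' rfl rfl fun x z h =>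
    QuarticOrder.eq_zero_of_normForm_25_300_neg50_0 (P := z) ?_
  rw [← h, QuarticOrder.normForm, eval]
  ring

lemma RepresentsOne.eq_of_36_12_64_48_1 (h : RepresentsOne s ⟨36, 12, 64, 48, 1⟩) : s = 25 := by
  refine h.eq_of_root' rfl rfl fun x z h =>
    QuarticOrder.eq_zero_of_normForm_36_12_64_48 (P := z) ?_
  rw [← h, QuarticOrder.normForm, eval]
  ring

lemma RepresentsOne.eq_of_81_12_neg26_neg32_1 (h : RepresentsOne s ⟨81, 12, -26, -32, 1⟩) : s = 12 := by
  refine h.eq_of_root' rfl rfl fun x z h =>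
    QuarticOrder.eq_zero_of_normForm_81_12_neg26_neg32 (P := z) ?_
  rw [← h, QuarticOrder.normForm, eval]
  ring

lemma RepresentsOne.eq_of_100_300_40_0_1 (h : RepresentsOne s ⟨100, 300, 40, 0, 1⟩) : s = -3 := by
  refine h.eq_of_root' rfl rfl fun x z h =>
    QuarticOrder.eq_zero_of_normForm_100_300_40_0 (P := z) ?_
  rw [← h, QuarticOrder.normForm, eval]
  ring

lemma RepresentsOne.eq_of_121_168_neg86_12_1 (h : RepresentsOne s ⟨121, 168, -86, 12, 1⟩) : s = 3 := by
  refine h.eq_of_root' rfl rfl fun x z h =>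
    QuarticOrder.eq_zero_of_normForm_121_168_neg86_12 (P := z) ?_
  rw [← h, QuarticOrder.normForm, eval]
  ring

lemma RepresentsOne.sq_ne (h : RepresentsOne s ⟨41, 8, 64, -28, -4⟩) (M : ℤ) :
    M ^ 2 ≠ 8 * s + 25 := by
  obtain ⟨x, z, h₁, h₂⟩ := h
  simp only [eval, hessian] at h₁ h₂
  have hs : s = -155 * x ^ 4 + 110 * x ^ 3 * z + 20 * x * z ^ 3 + 25 * z ^ 4 := by linarith
  rw [hs]
  exact QuarticOrder.sq_ne_of_quartic_eq_one (by linear_combination h₁)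

lemma not_representsOne : ¬ RepresentsOne s ⟨81, 72, 64, -12, -4⟩ := by
  rintro ⟨x, z, h, -⟩
  have h' := congrArg (Int.cast : ℤ → ZMod 3) h
  simp only [eval] at h'
  push_cast at h'
  generalize (x : ZMod 3) = x at h'
  generalize (z : ZMod 3) = z at h'
  revert x z
  decide

lemma RepresentsOne.eq_of_mem_survivors {F : BinaryQuartic} (h : RepresentsOne s F)
    (hF : F ∈ survivors) {M : ℤ} (hM : M ^ 2 = 8 * s + 25) :
    s ∈ [-2, 63, 45, 0, 25, 12, -3, 3] := by
  simp only [survivors, List.mem_cons, List.not_mem_nil, or_false] at hF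
  rcases hF with rfl | rfl | rfl | rfl | rfl | rfl | rfl | rfl | rfl | rfl | rfl | rfl
  · have := RepresentsOne.eq_of_1_4_16_neg276_neg64
      (h.of_subst 1 1 0 (-1) (by decide +kernel) (by norm_num))
    simp [this]
  · have := RepresentsOne.eq_of_16_12_4_neg72_1
      (h.of_subst 1 0 0 (-1) (by decide +kernel) (by norm_num))
    simp [this]
  · have := RepresentsOne.eq_of_25_0_neg50_60_1
      (h.of_subst 1 1 1 0 (by decide +kernel) (by norm_num))
    simp [this]
  · have := RepresentsOne.eq_of_25_300_neg50_0_1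
      (h.of_subst 0 1 1 0 (by decide +kernel) (by norm_num))
    simp [this]
  · have := RepresentsOne.eq_of_36_12_64_48_1
      (h.of_subst 1 0 0 1 (by decide +kernel) (by norm_num))
    simp [this]
  · exact absurd hM (RepresentsOne.sq_ne
      (h.of_subst 1 0 0 (-1) (by decide +kernel) (by norm_num)) M)
  · have := RepresentsOne.eq_of_81_12_neg26_neg32_1
      (h.of_subst 0 1 (-1) 8 (by decide +kernel) (by norm_num))
    simp [this]
  · have := RepresentsOne.eq_of_81_12_neg26_neg32_1
      (h.of_subst (-1) 0 1 1 (by decide +kernel) (by norm_num))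
    simp [this]
  · exact absurd (h.of_subst 1 0 (-1) 1 (by decide +kernel) (by norm_num)) not_representsOne
  · exact absurd (h.of_subst 0 1 (-1) (-1) (by decide +kernel) (by norm_num)) not_representsOne
  · have := RepresentsOne.eq_of_100_300_40_0_1
      (h.of_subst 0 1 1 0 (by decide +kernel) (by norm_num))
    simp [this]
  · have := RepresentsOne.eq_of_121_168_neg86_12_1
      (h.of_subst 0 1 1 (-3) (by decide +kernel) (by norm_num))
    simp [this]

end BinaryQuartic

namespace BinaryQuartic

/-- The quartic attached to a point of `5 Z² = 4 s³ + 20 s² + 24 s + 45`. -/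
def ofPoint (s Z : ℤ) : BinaryQuartic :=
  ⟨1, 0, -(50 + 30 * s), -100 * Z, 25 - 250 * s - 75 * s ^ 2⟩

variable {s Z : ℤ}

lemma isPowMod_ofPoint : (ofPoint s Z).IsPowMod := by
  refine ⟨1, 5 * (s + 1), ?_⟩
  simp only [ofPoint]
  push_cast
  generalize (s : ZMod 20) = s
  generalize (Z : ZMod 20) = Z
  revert s Z
  decide

lemma eval_ofPoint_ne_zero {u v : ℤ} (h : IsCoprime u v) : (ofPoint s Z).eval u v ≠ 0 := by
  intro h0
  simp only [eval, ofPoint] at h0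
  have hp : Prime (5 : ℤ) := by norm_num
  obtain ⟨w, rfl⟩ : 5 ∣ u := hp.dvd_of_dvd_pow (n := 4)
    ⟨(10 + 6 * s) * u ^ 2 * v ^ 2 + 20 * Z * u * v ^ 3 - (5 - 50 * s - 15 * s ^ 2) * v ^ 4,
      by linear_combination h0⟩
  have h1 : 5 * (5 * w ^ 4 - (10 + 6 * s) * w ^ 2 * v ^ 2 - 4 * Z * w * v ^ 3 - 2 * s * v ^ 4) +
      (1 - 3 * s ^ 2) * v ^ 4 = 0 :=
    mul_left_cancel₀ (by norm_num : (25 : ℤ) ≠ 0) (by linear_combination h0)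
  have h2 := congrArg (Int.cast : ℤ → ZMod 5) h1
  push_cast at h2
  rw [show (5 : ZMod 5) = 0 from rfl, zero_mul, zero_add] at h2
  have h3 : (v : ZMod 5) = 0 := by
    generalize (s : ZMod 5) = s at h2
    generalize (v : ZMod 5) = v at h2
    revert s v
    decide
  exact hp.not_isUnit (h.isUnit_of_dvd' (dvd_mul_right _ _)
    ((ZMod.intCast_zmod_eq_zero_iff_dvd v 5).1 h3))

lemma isAdmissible_ofPoint (h : 5 * Z ^ 2 = 4 * s ^ 3 + 20 * s ^ 2 + 24 * s + 45) :
    IsAdmissible s (ofPoint s Z) where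
  invI := by
    simp only [invI, ofPoint]
    ring
  invJ := by
    simp only [invJ, ofPoint]
    linear_combination (-54000) * h
  isPowMod := isPowMod_ofPoint
  representsOne := ⟨1, 0, by simp [eval, ofPoint], by
    simp only [eval, hessian, ofPoint]
    ring⟩
  eval_ne_zero _ _ := eval_ofPoint_ne_zero

lemma exists_subst_hasHighRoot {F : BinaryQuartic} (hI : F.invI = 2800) (hJ : F.invJ = -2270000)
    (ha : F.a = 1) : ∃ p q r t, p * t - q * r = 1 ∧ (F.subst p q r t).HasHighRoot := by
  obtain ⟨w, hw, hw0⟩ := Complex.exists_quartic_root_im_pos F.b F.c F.d F.e (by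
    simp only [invI, invJ, ha] at hI hJ
    have h1 : (12 * F.e - 3 * F.b * F.d + F.c ^ 2 : ℝ) = 2800 := by
      exact_mod_cast (by linarith : 12 * F.e - 3 * F.b * F.d + F.c ^ 2 = 2800)
    have h2 : (72 * F.c * F.e + 9 * F.b * F.c * F.d - 27 * F.d ^ 2 - 27 * F.e * F.b ^ 2 -
        2 * F.c ^ 3 : ℝ) = -2270000 := by
      exact_mod_cast (by linarith : 72 * F.c * F.e + 9 * F.b * F.c * F.d - 27 * F.d ^ 2 -
        27 * F.e * F.b ^ 2 - 2 * F.c ^ 3 = -2270000)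
    rw [h1]
    have h3 : (72 * F.c * F.e + 9 * F.b * F.c * F.d - 27 * F.d ^ 2 - 27 * F.e * F.b ^ 2 -
        2 * F.c ^ 3 : ℝ) ^ 2 = 2270000 ^ 2 := by rw [h2]; norm_num
    norm_num at h3 ⊢
    linarith)
  obtain ⟨g, hg⟩ := ModularGroup.exists_smul_mem_fd ⟨w, hw0⟩
  have him := ModularGroup.three_le_four_mul_im_sq_of_mem_fd hg
  have hdet := g.det_coe
  rw [Matrix.det_fin_two] at hdet
  have hw' := UpperHalfPlane.coe_specialLinearGroup_apply g ⟨w, hw0⟩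
  have hD : (g 1 0 : ℂ) * w + g 1 1 ≠ 0 := by
    simpa [UpperHalfPlane.denom] using UpperHalfPlane.denom_ne_zero g ⟨w, hw0⟩
  simp only [algebraMap_int_eq, eq_intCast, Complex.ofReal_intCast] at hw'
  rw [eq_div_iff hD] at hw'
  refine ⟨g 1 1, -g 0 1, -g 1 0, g 0 0, by linarith,
    ((g • (⟨w, hw0⟩ : UpperHalfPlane) : UpperHalfPlane) : ℂ), ?_, ?_⟩
  · rw [UpperHalfPlane.coe_im]
    linarith
  generalize ((g • (⟨w, hw0⟩ : UpperHalfPlane) : UpperHalfPlane) : ℂ) = w' at hw'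
  have hdet' : (g 0 0 * g 1 1 - g 0 1 * g 1 0 : ℂ) = 1 := by exact_mod_cast hdet
  generalize g 0 0 = α at *
  generalize g 0 1 = β at *
  generalize g 1 0 = γ at *
  generalize g 1 1 = δ at *
  have h1 : (γ * w + δ) * (δ * w' - β) = w := by linear_combination δ * hw' + w * hdet'
  have h2 : (γ * w + δ) * (α - γ * w') = 1 := by linear_combination -γ * hw' + hdet'
  refine (mul_eq_zero.1 ?_).resolve_left (pow_ne_zero 4 hD)
  transitivity F.a * ((γ * w + δ) * (δ * w' - β)) ^ 4 +
    F.b * ((γ * w + δ) * (δ * w' - β)) ^ 3 * ((γ * w + δ) * (α - γ * w')) +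
    F.c * ((γ * w + δ) * (δ * w' - β)) ^ 2 * ((γ * w + δ) * (α - γ * w')) ^ 2 +
    F.d * ((γ * w + δ) * (δ * w' - β)) * ((γ * w + δ) * (α - γ * w')) ^ 3 +
    F.e * ((γ * w + δ) * (α - γ * w')) ^ 4
  · generalize (γ * w + δ : ℂ) = D
    simp only [BinaryQuartic.subst, eval]
    push_cast
    ring
  · rw [h1, h2, ha, ← hw]
    push_cast
    ring

/-- The integral points of `5 Z² = 4 s³ + 20 s² + 24 s + 45` for which `8 s + 25` is a square. -/
theorem mem_of_point {M : ℤ} (h : 5 * Z ^ 2 = 4 * s ^ 3 + 20 * s ^ 2 + 24 * s + 45)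
    (hM : M ^ 2 = 8 * s + 25) : s ∈ [-2, 63, 45, 0, 25, 12, -3, 3] := by
  have hP := isAdmissible_ofPoint h
  obtain ⟨p, q, r, t, hD, hF⟩ := exists_subst_hasHighRoot hP.invI hP.invJ rfl
  obtain ⟨G, hG, hGr⟩ := (hP.subst (.inl hD)).exists_isReduced hF
  rcases mem_survivors hGr hG.invI hG.invJ hG.isPowMod with ⟨h1, h2, h3, h4, h5⟩ | hmem
  · obtain ⟨u, v, huv, -⟩ := hG.representsOne
    have : (5 : ℤ) ∣ 1 := by
      rw [← huv, eval]
      exact dvd_add (dvd_add (dvd_add (dvd_add (h1.mul_right _) ((h2.mul_right _).mul_right _))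
        ((h3.mul_right _).mul_right _)) ((h4.mul_right _).mul_right _)) (h5.mul_right _)
    norm_num at this
  · exact hG.representsOne.eq_of_mem_survivors hmem hM

end BinaryQuartic

theorem binom_2_6_collisions (n m : ℕ) (hn : 4 ≤ n) (hm : 12 ≤ m) :
    Nat.choose n 2 = Nat.choose m 6 ↔ (n, m) = (78, 14) := by
  refine ⟨fun h => ?_, fun h => ?_⟩
  · obtain ⟨j, rfl⟩ := Nat.exists_eq_add_of_le' hn
    obtain ⟨k, rfl⟩ := Nat.exists_eq_add_of_le' hm
    have h1 := Nat.descFactorial_eq_factorial_mul_choose (j + 4) 2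
    have h2 := Nat.descFactorial_eq_factorial_mul_choose (k + 12) 6
    rw [← h] at h2
    simp only [Nat.descFactorial, Nat.factorial, Nat.reduceSubDiff, Nat.sub_zero] at h1 h2
    have h3 : (k + 12) * (k + 11) * (k + 10) * (k + 9) * (k + 8) * (k + 7) =
        360 * ((j + 4) * (j + 3)) := by linarith
    obtain ⟨s, hs⟩ : ∃ s : ℤ, (k + 12 : ℤ) * (k + 7) = 2 * s := by
      obtain ⟨i, hi⟩ := Int.even_or_odd' k
      rcases hi with hi | hi
      · exact ⟨(i + 6) * (k + 7), by rw [hi]; ring⟩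
      · exact ⟨(k + 12) * (i + 4), by rw [hi]; ring⟩
    have hs' : s ∈ [-2, 63, 45, 0, 25, 12, -3, 3] :=
      BinaryQuartic.mem_of_point (Z := 3 * (2 * j + 7)) (M := 2 * k + 19) (by
        zify at h3
        have h4 : 2 * s * (2 * s + 4) * (2 * s + 6) = 360 * ((j + 4) * (j + 3) : ℤ) := by
          rw [← h3, ← hs]
          ring
        linarith) (by linear_combination 4 * hs)
    have hs63 : s ≤ 63 := by
      simp only [List.mem_cons, List.not_mem_nil, or_false] at hs'
      omega
    have hk : k ≤ 2 := by
      by_contra! hk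
      zify at hk
      nlinarith
    obtain rfl : k = 2 := by
      simp only [List.mem_cons, List.not_mem_nil, or_false] at hs'
      interval_cases k <;> push_cast at hs <;> omega
    have hj : j = 74 := by
      rcases lt_trichotomy j 74 with hj | hj | hj
      · nlinarith
      · exact hj
      · nlinarith
    rw [hj]
  · obtain ⟨rfl, rfl⟩ := Prod.ext_iff.1 h
    decide +kernel
end

section
/- There are no natural numbers n, m with n ≥ 6 and m ≥ 8 satisfying C(n, 3) = C(m, 4), where C denotes the binomial coefficient. -/
/-! The equation `C(n, 3) = C(m, 4)` says that `(n - 1, m² - 3m + 1)` is an integral point of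
`Y² = 4x³ - 4x + 1`. Let `φ³ = 4φ - 2`. A 2-descent, with the class group and unit computations
replaced by the reduction of a unimodular positive ternary quadratic form, shows that `2(2x - φ)`
is a square in `ℤ[φ]` for every integral point with `x > 0`; comparing coefficients then gives
`x ∈ {1, 2, 6}`. -/

theorem Int.exists_abs_two_mul_add_mul_le (f : ℤ) {a : ℤ} (ha : 0 < a) :
    ∃ k : ℤ, |2 * (f + k * a)| ≤ a := by
  refine ⟨-((2 * f + a) / (2 * a)), ?_⟩
  have h1 := Int.emod_add_mul_ediv (2 * f + a) (2 * a)
  have h2 := Int.emod_nonneg (2 * f + a) (show 2 * a ≠ 0 by omega)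
  have h3 := Int.emod_lt_of_pos (2 * f + a) (show 0 < 2 * a by omega)
  rw [abs_le]
  constructor <;> nlinarith

/-- A positive definite integral ternary quadratic form of determinant one represents one. -/
theorem exists_ternary_form_eq_one (a b c d e f : ℤ) (ha : 0 < a) (hD : 0 < a * b - f ^ 2)
    (hdet : a * b * c + 2 * d * e * f - a * d ^ 2 - b * e ^ 2 - c * f ^ 2 = 1) :
    ∃ X Y Z : ℤ, a * X ^ 2 + b * Y ^ 2 + c * Z ^ 2 + 2 * d * Y * Z + 2 * e * X * Z
      + 2 * f * X * Y = 1 := by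
  induction hN : (a + (a * b - f ^ 2)).toNat using Nat.strong_induction_on
    generalizing a b c d e f with
  | _ N ih =>
  by_cases h₁ : 4 * (a * b - f ^ 2) < 3 * a ^ 2
  · obtain ⟨k, hk⟩ := Int.exists_abs_two_mul_add_mul_le f ha
    have hw : 4 * (f + k * a) ^ 2 ≤ a ^ 2 := by
      have := sq_le_sq' (abs_le.mp hk).1 (abs_le.mp hk).2
      linarith
    have hb : a * (b + 2 * k * f + k ^ 2 * a) = (a * b - f ^ 2) + (f + k * a) ^ 2 := by ring
    have hlt : b + 2 * k * f + k ^ 2 * a < a := by nlinarith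
    have hpos : 0 < b + 2 * k * f + k ^ 2 * a := by
      refine pos_of_mul_pos_right (a := a) ?_ ha.le
      rw [hb]; positivity
    have hD' : (b + 2 * k * f + k ^ 2 * a) * a - (f + k * a) ^ 2 = a * b - f ^ 2 := by ring
    obtain ⟨X, Y, Z, h⟩ := ih _ (by rw [← hN, hD']; omega)
      (b + 2 * k * f + k ^ 2 * a) a c e (d + k * e) (f + k * a) hpos (by rw [hD']; exact hD)
      (by linear_combination hdet) rfl
    exact ⟨Y + k * X, X, Z, by linear_combination h⟩
  · by_cases h₂ : 4 * a < 3 * (a * b - f ^ 2) ^ 2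
    · obtain ⟨k, hk⟩ := Int.exists_abs_two_mul_add_mul_le (a * d - e * f) hD
      have hw : 4 * (a * d - e * f + k * (a * b - f ^ 2)) ^ 2 ≤ (a * b - f ^ 2) ^ 2 := by
        have := sq_le_sq' (abs_le.mp hk).1 (abs_le.mp hk).2
        linarith
      have hb : (a * b - f ^ 2) * (a * (c + 2 * k * d + k ^ 2 * b) - (e + k * f) ^ 2)
          = a + (a * d - e * f + k * (a * b - f ^ 2)) ^ 2 := by
        linear_combination a * hdet
      have hlt : a * (c + 2 * k * d + k ^ 2 * b) - (e + k * f) ^ 2 < a * b - f ^ 2 := by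
        nlinarith
      have hpos : 0 < a * (c + 2 * k * d + k ^ 2 * b) - (e + k * f) ^ 2 := by
        refine pos_of_mul_pos_right (a := a * b - f ^ 2) ?_ hD.le
        rw [hb]; positivity
      obtain ⟨X, Y, Z, h⟩ := ih _ (by rw [← hN]; omega)
        a (c + 2 * k * d + k ^ 2 * b) b (d + k * b) f (e + k * f) ha hpos
        (by linear_combination hdet) rfl
      exact ⟨X, Z + k * Y, Y, by linear_combination h⟩
    · have ha1 : a = 1 := by
        by_contra hne
        have h2 : 2 ≤ a := by omega
        have h3 : 9 * a ^ 4 ≤ 16 * (a * b - f ^ 2) ^ 2 := by nlinarith [sq_nonneg a]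
        have h4 : 0 < a * (27 * a ^ 3 - 64) := by
          have : 2 ^ 3 ≤ a ^ 3 := by gcongr
          exact mul_pos ha (by linarith)
        nlinarith
      exact ⟨1, 0, 0, by rw [ha1]; ring⟩

/-- The norm of `p + qφ + rφ²`, where `φ³ = 4φ - 2`. -/
def cubicNorm (p q r : ℤ) : ℤ :=
  p * ((p + 4 * r) ^ 2 - q * (4 * q - 2 * r)) - q * (-2 * r * (p + 4 * r) + 2 * q ^ 2)
    + r * (-2 * r * (4 * q - 2 * r) + 2 * q * (p + 4 * r))

theorem cubicNorm_sq (p q r : ℤ) :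
    cubicNorm p q r ^ 2 = cubicNorm (p ^ 2 - 4 * q * r) (2 * p * q + 8 * q * r - 2 * r ^ 2)
      (q ^ 2 + 2 * p * r + 4 * r ^ 2) := by
  unfold cubicNorm; ring

theorem cubicNorm_sub_mul (X p q r : ℤ) :
    (X ^ 3 - 4 * X + 2) * cubicNorm p q r =
      cubicNorm (X * p + 2 * r) (X * q - p - 4 * r) (X * r - q) := by
  unfold cubicNorm; ring

/-- The possible entries of a positive semidefinite Gram matrix
`!![1, u, r; u, r, 4 * u - 2; r, 4 * u - 2, 4 * r - 2 * u]` whose determinant is a square. -/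
theorem eq_of_gram_det_eq_sq {u r k : ℤ} (hur : u ^ 2 ≤ r) (hru : r ^ 2 ≤ 4 * r - 2 * u)
    (hk : r * (4 * r - 2 * u) - (4 * u - 2) ^ 2 - u * (u * (4 * r - 2 * u) - r * (4 * u - 2))
      + r * (u * (4 * u - 2) - r ^ 2) = k ^ 2) :
    (u = 0 ∧ r = 2) ∨ (u = -1 ∧ r = 3) ∨ (u = 1 ∧ r = 3) := by
  have hr0 : 0 ≤ r := (sq_nonneg u).trans hur
  have hu : -u ≤ r := by
    have := Int.le_self_sq (-u)
    rw [neg_sq] at this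
    exact this.trans hur
  have hr6 : r ≤ 6 := by
    by_contra! hlt
    nlinarith
  have hu2 : u ≤ 2 := by
    by_contra! hlt
    nlinarith
  have hu2' : -2 ≤ u := by
    by_contra! hlt
    nlinarith
  have hne : ∀ n : ℤ, n = k ^ 2 → n ≠ 2 ∧ n ≠ 5 ∧ 0 ≤ n := by
    rintro n rfl
    refine ⟨fun h => ?_, fun h => ?_, sq_nonneg k⟩
    all_goals
      have : k ≤ 2 := by by_contra! hlt; nlinarith
      have : -2 ≤ k := by by_contra! hlt; nlinarith
      interval_cases k <;> omega
  have := hne _ hk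
  clear hk hne
  interval_cases u <;> interval_cases r <;> omega

/-- The ternary form attached to an integral point `(x, Y)`, up to a positive factor a sum of
squares. -/
theorem ternary_form_nonneg {x Y : ℤ} (hx : 0 < x) (h : Y ^ 2 = 4 * x ^ 3 - 4 * x + 1)
    (a b c : ℤ) :
    0 ≤ (4 * x ^ 2 - 2) * a ^ 2 - 2 * Y * a * b + x * b ^ 2 - 2 * b * c
      + (2 * x + 1) * c ^ 2 := by
  have h2 : 0 < 2 * x - 1 := by omega
  refine (mul_nonneg_iff_of_pos_left (mul_pos hx h2)).mp ?_
  have key : x * (2 * x - 1) * ((4 * x ^ 2 - 2) * a ^ 2 - 2 * Y * a * b + x * b ^ 2 - 2 * b * c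
      + (2 * x + 1) * c ^ 2) = (2 * x - 1) * (x * b - Y * a - c) ^ 2
        + ((2 * x - 1) * a - Y * c) ^ 2 + x * c ^ 2 := by
    linear_combination (-(2 * x - 1) * a ^ 2 - c ^ 2) * h
  rw [key]
  positivity

/-- For an integral point `(x, Y)` of `Y² = 4x³ - 4x + 1` with `x > 0`, the element `2(2x - φ)` is
the square of some `a + bφ + cφ²`, where `φ³ = 4φ - 2`. -/
theorem exists_sq_eq_two_mul_sub {x Y : ℤ} (hx : 0 < x) (h : Y ^ 2 = 4 * x ^ 3 - 4 * x + 1) :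
    ∃ a b c : ℤ, a ^ 2 - 4 * b * c = 4 * x ∧ 2 * a * b + 8 * b * c - 2 * c ^ 2 = -2 ∧
      b ^ 2 + 2 * a * c + 4 * c ^ 2 = 0 := by
  obtain ⟨B, C, A, hq⟩ := exists_ternary_form_eq_one x (2 * x + 1) (4 * x ^ 2 - 2) 0 (-Y) (-1) hx
    (by nlinarith) (by linear_combination (-(2 * x + 1)) * h)
  -- `β = b₀ + b₁φ + b₂φ²` satisfies `β² = (2x - φ)(2s + tφ + (1 - s)φ²)`
  obtain ⟨s, hs⟩ : ∃ s, s = A ^ 2 * (4 * x ^ 2 - 4) - 2 * Y * A * B + x * B ^ 2 + C ^ 2 := ⟨_, rfl⟩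
  obtain ⟨t, ht⟩ : ∃ t, t = 4 * x * A ^ 2 - 4 * Y * A * C + 4 * x * B * C - B ^ 2 - 4 * C ^ 2 :=
    ⟨_, rfl⟩
  have hg : 1 - s = 2 * A ^ 2 + 2 * x * C ^ 2 - 2 * B * C := by linear_combination -hq - hs
  obtain ⟨b₀, hb₀⟩ : ∃ b₀, b₀ = 2 * Y * A - 2 * x * B := ⟨_, rfl⟩
  obtain ⟨b₁, hb₁⟩ : ∃ b₁, b₁ = B - 2 * x * C := ⟨_, rfl⟩
  have e₀ : b₀ ^ 2 - 4 * b₁ * C = 2 * x * (2 * s) + 2 * (1 - s) := by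
    rw [hg, hs, hb₀, hb₁]; linear_combination 4 * A ^ 2 * h
  have e₁ : 2 * b₀ * b₁ + 8 * b₁ * C - 2 * C ^ 2 = 2 * x * t - 2 * s - 4 * (1 - s) := by
    rw [hg, hs, ht, hb₀, hb₁]; ring
  have e₂ : b₁ ^ 2 + 2 * b₀ * C + 4 * C ^ 2 = 2 * x * (1 - s) - t := by
    rw [hg, ht, hb₀, hb₁]; ring
  obtain ⟨u, hu⟩ : ∃ u, u = s + t - 1 := ⟨_, rfl⟩
  obtain ⟨r, hr⟩ : ∃ r, r = 4 - 2 * s - t := ⟨_, rfl⟩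
  have hur : u ^ 2 ≤ r := by
    have := ternary_form_nonneg hx h (2 * x * A - Y * C - u * A)
      (2 * Y * A + (4 - 4 * x ^ 2) * C - u * B) (B - 2 * x * C - u * C)
    have key : (4 * x ^ 2 - 2) * (2 * x * A - Y * C - u * A) ^ 2
        - 2 * Y * (2 * x * A - Y * C - u * A) * (2 * Y * A + (4 - 4 * x ^ 2) * C - u * B)
        + x * (2 * Y * A + (4 - 4 * x ^ 2) * C - u * B) ^ 2
        - 2 * (2 * Y * A + (4 - 4 * x ^ 2) * C - u * B) * (B - 2 * x * C - u * C)
        + (2 * x + 1) * (B - 2 * x * C - u * C) ^ 2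
        = -t + 2 * s + 4 * (1 - s) - 2 * u * (t - (1 - s)) + u ^ 2 * (s + (1 - s)) := by
      rw [hg, hs, ht]
      linear_combination (-4 * x ^ 2 * C ^ 2 + 6 * C ^ 2 - 4 * x * A ^ 2 + 4 * Y * A * C
        - 2 * B * C * u + 4 * A ^ 2 * u) * h
    rw [key] at this
    rw [hu] at this ⊢
    rw [hr]
    linarith
  have hru : r ^ 2 ≤ 4 * r - 2 * u := by
    have := ternary_form_nonneg hx h (4 * x ^ 2 * A - Y * B - r * A)
      (4 * x * Y * A - 2 * Y ^ 2 * C + 4 * B - 8 * x * C - 4 * x ^ 2 * B + 8 * x ^ 3 * C - r * B)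
      (2 * Y * A + 4 * C - 2 * x * B - r * C)
    have key : (4 * x ^ 2 - 2) * (4 * x ^ 2 * A - Y * B - r * A) ^ 2
        - 2 * Y * (4 * x ^ 2 * A - Y * B - r * A)
          * (4 * x * Y * A - 2 * Y ^ 2 * C + 4 * B - 8 * x * C - 4 * x ^ 2 * B + 8 * x ^ 3 * C
            - r * B)
        + x * (4 * x * Y * A - 2 * Y ^ 2 * C + 4 * B - 8 * x * C - 4 * x ^ 2 * B
            + 8 * x ^ 3 * C - r * B) ^ 2
        - 2 * (4 * x * Y * A - 2 * Y ^ 2 * C + 4 * B - 8 * x * C - 4 * x ^ 2 * B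
            + 8 * x ^ 3 * C - r * B) * (2 * Y * A + 4 * C - 2 * x * B - r * C)
        + (2 * x + 1) * (2 * Y * A + 4 * C - 2 * x * B - r * C) ^ 2
        = 4 * (-t + 2 * s + 4 * (1 - s)) - 2 * (t - (1 - s))
          - 2 * r * (-t + 2 * s + 4 * (1 - s)) + r ^ 2 * (s + (1 - s)) := by
      rw [hg, hs, ht]
      linear_combination (-4 * x ^ 2 * B ^ 2 + 6 * B ^ 2 - 16 * x ^ 3 * A ^ 2 + 8 * x * Y * A * B
        - 4 * Y ^ 2 * B * C - 24 * x * B * C + 16 * x ^ 3 * B * C - 2 * B ^ 2 * r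
        + 8 * x * A ^ 2 * r - 4 * Y * A * C * r + 4 * x * Y ^ 2 * C ^ 2 + 16 * x ^ 2 * C ^ 2
        - 16 * x ^ 4 * C ^ 2 + 4 * x * B * C * r - 8 * x * A ^ 2 + 8 * Y * A * C + 16 * C ^ 2
        - 4 * C ^ 2 * r + 4 * A ^ 2 - 4 * B * C + 4 * x * C ^ 2) * h
    rw [key] at this
    rw [hr] at this ⊢
    rw [hu]
    linarith
  obtain ⟨k, hk⟩ : ∃ k : ℤ, r * (4 * r - 2 * u) - (4 * u - 2) ^ 2
      - u * (u * (4 * r - 2 * u) - r * (4 * u - 2)) + r * (u * (4 * u - 2) - r ^ 2) = k ^ 2 := by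
    have hN : cubicNorm b₀ b₁ C ^ 2 = (2 * Y) ^ 2 * (r * (4 * r - 2 * u) - (4 * u - 2) ^ 2
        - u * (u * (4 * r - 2 * u) - r * (4 * u - 2)) + r * (u * (4 * u - 2) - r ^ 2)) := by
      have h1 := cubicNorm_sub_mul (2 * x) (2 * s) t (1 - s)
      have h2 : (2 * x) ^ 3 - 4 * (2 * x) + 2 = 2 * Y ^ 2 := by linear_combination (-2) * h
      rw [cubicNorm_sq, e₀, e₁, e₂, ← h1, h2, hu, hr]
      unfold cubicNorm
      ring
    have hY : 2 * Y ≠ 0 := by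
      rintro h0
      obtain rfl : Y = 0 := by omega
      have : 2 * (2 * x ^ 3 - 2 * x) = -1 := by linarith
      omega
    obtain ⟨k, hk⟩ := (Int.pow_dvd_pow_iff two_ne_zero).mp (Dvd.intro _ hN.symm)
    refine ⟨k, mul_left_cancel₀ (pow_ne_zero 2 hY) ?_⟩
    rw [← hN, hk]; ring
  have hcases : (s = 1 ∧ t = 0) ∨ (s = 1 ∧ t = -1) ∨ (s = -1 ∧ t = 3) := by
    have := eq_of_gram_det_eq_sq hur hru hk
    omega
  rcases hcases with ⟨rfl, rfl⟩ | ⟨rfl, rfl⟩ | ⟨rfl, rfl⟩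
  · exact ⟨b₀, b₁, C, by linear_combination e₀, by linear_combination e₁, by linear_combination e₂⟩
  · refine ⟨-2 * b₀ - 2 * b₁ - 2 * C, b₀ + 2 * b₁ + 2 * C, b₀ + b₁ + 2 * C, ?_, ?_, ?_⟩
    · linear_combination -4 * e₂ - 2 * e₁
    · linear_combination 2 * e₀ + 8 * e₂ - 2 * e₂ + 4 * e₁
    · linear_combination 2 * e₁ + e₀ + 4 * e₂
  · refine ⟨-4 * b₀ - 2 * b₁ - 2 * C, b₀ + 2 * C, b₀ + b₁, ?_, ?_, ?_⟩
    · linear_combination 12 * e₀ + 4 * e₂ + 6 * e₁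
    · linear_combination 12 * e₁ - 2 * e₀ - 8 * e₂ + 6 * e₂ - 12 * e₁
    · linear_combination 12 * e₂ - 2 * e₁ - 3 * e₀ - 12 * e₂

theorem eq_one_or_two_or_six_of_sq_eq {x Y : ℤ} (hx : 0 < x)
    (h : Y ^ 2 = 4 * x ^ 3 - 4 * x + 1) : x = 1 ∨ x = 2 ∨ x = 6 := by
  obtain ⟨a, b, c, h₀, h₁, h₂⟩ := exists_sq_eq_two_mul_sub hx h
  have hbac : b * (a + 4 * c) = c ^ 2 - 1 := by linarith
  have hc : IsUnit c := by
    have hcop : IsCoprime c (b ^ 2) :=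
      IsCoprime.pow_right ⟨c, -(a + 4 * c), by linear_combination -hbac⟩
    exact hcop.isUnit_of_dvd' dvd_rfl ⟨-(2 * a + 4 * c), by linear_combination h₂⟩
  have hc2 : c ^ 2 = 1 := Int.isUnit_sq hc
  rcases mul_eq_zero.mp (hbac.trans (sub_eq_zero.mpr hc2)) with rfl | hac
  · have : a = -2 * c := by
      have : c * (a + 2 * c) = 0 := by linarith
      have := (mul_eq_zero.mp this).resolve_left hc.ne_zero
      linarith
    subst this
    left; linarith
  · obtain rfl : a = -4 * c := by linarith
    have hb : (b * c - 2) * (b * c + 2) = 0 := by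
      linear_combination c ^ 2 * h₂ + 4 * (c ^ 2 + 1) * hc2
    rcases mul_eq_zero.mp hb with hb | hb
    · right; left; linarith
    · right; right; linarith

theorem binom_3_4_no_collisions (n m : ℕ) (hn : 6 ≤ n) (hm : 8 ≤ m) :
    Nat.choose n 3 ≠ Nat.choose m 4 := by
  intro h
  obtain ⟨p, rfl⟩ := Nat.exists_eq_add_of_le hn
  obtain ⟨q, rfl⟩ := Nat.exists_eq_add_of_le hm
  have h3 := Nat.descFactorial_eq_factorial_mul_choose (6 + p) 3
  have h4 := Nat.descFactorial_eq_factorial_mul_choose (8 + q) 4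
  have e : 4 * Nat.descFactorial (6 + p) 3 = Nat.descFactorial (8 + q) 4 := by
    rw [h3, h4, h]; simp only [Nat.factorial]; ring
  have e' : 4 * ((p + 6) * (p + 5) * (p + 4) : ℤ) = (q + 8) * (q + 7) * (q + 6) * (q + 5) := by
    have h₁ : 6 + p - 1 = p + 5 := by omega
    have h₂ : 6 + p - 2 = p + 4 := by omega
    have h₃ : 8 + q - 1 = q + 7 := by omega
    have h₄ : 8 + q - 2 = q + 6 := by omega
    have h₅ : 8 + q - 3 = q + 5 := by omega
    simp only [Nat.descFactorial, h₁, h₂, h₃, h₄, h₅, Nat.sub_zero, mul_one] at e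
    have := congrArg (Nat.cast : ℕ → ℤ) e
    push_cast at this
    linear_combination this
  have hY : ((q : ℤ) ^ 2 + 13 * q + 41) ^ 2 = 4 * ((p : ℤ) + 5) ^ 3 - 4 * (p + 5) + 1 := by
    linear_combination -e'
  have hx := eq_one_or_two_or_six_of_sq_eq (by positivity) hY
  obtain rfl : p = 1 := by omega
  have : 0 ≤ (q : ℤ) := by positivity
  push_cast at hY
  nlinarith
end
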